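/- Let a ∈ C^∞(ℝ^n_x × ℝ^n_y) satisfy |∂_x^α ∂_y^β a(x,y)| ≤ C_{αβ} for all multi-indices with |α|, |β| ≤ 2n+1, and let φ ∈ C^∞(ℝ^n_x × ℝ^n_y) be real-valued such that |det ∂_x∂_y φ(x,y)| ≥ C₀ > 0 for all (x,y), and every entry h(x,y) of the mixed Hessian matrix ∂_x∂_y φ satisfies |∂_x^α h(x,y)| ≤ C_α and |∂_y^β h(x,y)| ≤ C_β for all (x,y) and all |α|, |β| ≤ 2n+1. Then the oscillatory integral operator I_φ u(x) = ∫_{ℝ^n} e^{iφ(x,y)} a(x,y) u(y) dy, defined for Schwartz functions u, satisfies ‖I_φ u‖_{L²(ℝ^n)} ≤ C · A · ‖u‖_{L²(ℝ^n)}, where A = sup_{|α|,|β| ≤ 2n+1} ‖∂_x^α ∂_y^β a‖_{L^∞(ℝ^n×ℝ^n)} and C depends only on n, C₀ and the constants C_α, C_β for the phase. -/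

import Mathlib

open MeasureTheory Complex SchwartzMap
open scoped BigOperators ENNReal Real

noncomputable section

/-- The derivative of `g` along the direction `v`. -/
def dLine {W F : Type*} [NormedAddCommGroup W] [NormedSpace ℝ W]
    [NormedAddCommGroup F] [NormedSpace ℝ F] (v : W) (g : W → F) : W → F :=
  fun z => fderiv ℝ g z v

/-- The iterated partial derivative `∂^α` along the coordinate directions `dirs`,
with multiplicities given by the multi-index `α`. -/
def mderiv {n : ℕ} {W F : Type*} [NormedAddCommGroup W] [NormedSpace ℝ W]
    [NormedAddCommGroup F] [NormedSpace ℝ F]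
    (dirs : Fin n → W) (α : Fin n → ℕ) (g : W → F) : W → F :=
  ((List.ofFn fun i => (dLine (dirs i) (F := F))^[α i]).foldr (· ∘ ·) id) g

/-- The length `|α|` of a multi-index. -/
def mdeg {n : ℕ} (α : Fin n → ℕ) : ℕ := ∑ i, α i

/-- The first-factor (`x`) coordinate directions in `ℝ^n × ℝ^n`. -/
def dX {n : ℕ} (i : Fin n) : EuclideanSpace ℝ (Fin n) × EuclideanSpace ℝ (Fin n) :=
  (EuclideanSpace.single i 1, 0)

/-- The second-factor (`y`) coordinate directions in `ℝ^n × ℝ^n`. -/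
def dY {n : ℕ} (j : Fin n) : EuclideanSpace ℝ (Fin n) × EuclideanSpace ℝ (Fin n) :=
  (0, EuclideanSpace.single j 1)

/-- The entry `∂²φ/∂x_i∂y_j` of the mixed Hessian `∂_x ∂_y φ`. -/
def mixedHessXY {n : ℕ}
    (φ : EuclideanSpace ℝ (Fin n) × EuclideanSpace ℝ (Fin n) → ℝ) (i j : Fin n) :
    EuclideanSpace ℝ (Fin n) × EuclideanSpace ℝ (Fin n) → ℝ :=
  dLine (dX i) (dLine (dY j) φ)


set_option linter.all false


namespace Cotlar

/-- Sum of `f` over all lists of length `p` with entries in `J`. -/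
def lsum {J X : Type*} [Fintype J] [AddCommMonoid X] : ℕ → (List J → X) → X
  | 0, f => f []
  | p + 1, f => ∑ i, lsum p (fun w => f (i :: w))

variable {J H : Type*} [Fintype J] [NormedAddCommGroup H] [InnerProductSpace ℂ H] [CompleteSpace H]

/-- Alternating product of the operators along a word. -/
def word (T : J → H →L[ℂ] H) : Bool → List J → H →L[ℂ] H
  | _, [] => 1
  | true, i :: w => star (T i) * word T false w
  | false, i :: w => T i * word T true w

/-- Alternating power of a single operator. -/
def alt (S : H →L[ℂ] H) : Bool → ℕ → H →L[ℂ] H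
  | _, 0 => 1
  | true, p + 1 => star S * alt S false p
  | false, p + 1 => S * alt S true p

lemma lsum_mul_left (p : ℕ) (a : H →L[ℂ] H) (f : List J → H →L[ℂ] H) :
    lsum p (fun w => a * f w) = a * lsum p f := by
  induction p generalizing f with
  | zero => rfl
  | succ p ih => simp only [lsum, ih, Finset.mul_sum]

lemma alt_eq (T : J → H →L[ℂ] H) (p : ℕ) (b : Bool) :
    alt (∑ i, T i) b p = lsum p (word T b) := by
  induction p generalizing b with
  | zero => cases b <;> rfl
  | succ p ih =>
    cases b <;> simp only [alt, lsum, word, lsum_mul_left, ih, star_sum, Finset.sum_mul]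

lemma lsum_norm_le (p : ℕ) (f : List J → H →L[ℂ] H) (g : List J → ℝ) 
    (h : ∀ w, w.length = p → ‖f w‖ ≤ g w) : ‖lsum p f‖ ≤ lsum p g := by
  induction p generalizing f g with
  | zero => exact h [] rfl
  | succ p ih =>
    simp only [lsum]
    exact (norm_sum_le _ _).trans (Finset.sum_le_sum fun i _ => ih _ _ fun w hw => h _ (by simp [hw]))

/-- Bound by pairing off neighbours. -/
def pe (c : J → J → ℝ) (B : ℝ) : List J → ℝ
  | [] => 1
  | [_] => B
  | i :: j :: w => c i j ^ 2 * pe c B w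

/-- Chain weight. -/
def ch (c : J → J → ℝ) (B : ℝ) : List J → ℝ
  | [] => 1
  | [_] => B
  | i :: j :: w => c i j * ch c B (j :: w)

lemma pe_nonneg (c : J → J → ℝ) (B : ℝ) (hB : 0 ≤ B) : ∀ w, 0 ≤ pe c B w
  | [] => zero_le_one
  | [_] => hB
  | i :: j :: w => mul_nonneg (sq_nonneg _) (pe_nonneg c B hB w)

lemma ch_nonneg (c : J → J → ℝ) (B : ℝ) (hB : 0 ≤ B) (hc : ∀ i j, 0 ≤ c i j) : ∀ w, 0 ≤ ch c B w
  | [] => zero_le_one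
  | [_] => hB
  | i :: j :: w => mul_nonneg (hc _ _) (ch_nonneg c B hB hc (j :: w))

lemma norm_one_le' : ‖(1 : H →L[ℂ] H)‖ ≤ 1 := ContinuousLinearMap.norm_id_le

lemma word_le_pe (T : J → H →L[ℂ] H) (c : J → J → ℝ) (B : ℝ) (hT : ∀ i, ‖T i‖ ≤ B)
    (h1 : ∀ i j, ‖star (T i) * T j‖ ≤ c i j ^ 2) (h2 : ∀ i j, ‖T i * star (T j)‖ ≤ c i j ^ 2) :
    ∀ (w : List J) (b : Bool), ‖word T b w‖ ≤ pe c B w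
  | [], b => by cases b <;> exact norm_one_le'
  | [i], b => by cases b <;> simp [word, pe, norm_star, hT]
  | i :: j :: w, b => by
    cases b
    · simp only [word, pe, ← mul_assoc]
      exact (norm_mul_le _ _).trans (mul_le_mul (h2 i j) (word_le_pe T c B hT h1 h2 w _)
        (norm_nonneg _) (sq_nonneg _))
    · simp only [word, pe, ← mul_assoc]
      exact (norm_mul_le _ _).trans (mul_le_mul (h1 i j) (word_le_pe T c B hT h1 h2 w _)
        (norm_nonneg _) (sq_nonneg _))

lemma ch_sq (c : J → J → ℝ) (B : ℝ) : ∀ (w : List J) (i : J),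
    ch c B (i :: w) ^ 2 = pe c B (i :: w) * (B * pe c B w)
  | [], i => by simp [ch, pe]; ring
  | j :: w, i => by
    have := ch_sq c B w j
    simp only [ch, pe, mul_pow, this]
    ring

lemma word_le_ch (T : J → H →L[ℂ] H) (c : J → J → ℝ) (B : ℝ) (hB : 0 ≤ B)
    (hc : ∀ i j, 0 ≤ c i j) (hT : ∀ i, ‖T i‖ ≤ B)
    (h1 : ∀ i j, ‖star (T i) * T j‖ ≤ c i j ^ 2) (h2 : ∀ i j, ‖T i * star (T j)‖ ≤ c i j ^ 2)
    (w : List J) (b : Bool) : ‖word T b w‖ ≤ ch c B w := by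
  cases w with
  | nil => cases b <;> exact norm_one_le'
  | cons i w =>
    apply le_of_sq_le_sq _ (ch_nonneg c B hB hc _)
    rw [ch_sq, sq]
    refine mul_le_mul (word_le_pe T c B hT h1 h2 _ b) ?_ (norm_nonneg _) (pe_nonneg c B hB _)
    cases b
    · simp only [word]
      exact (norm_mul_le _ _).trans (mul_le_mul (hT i) (word_le_pe T c B hT h1 h2 w _)
        (norm_nonneg _) hB)
    · simp only [word]
      refine (norm_mul_le _ _).trans (mul_le_mul ?_ (word_le_pe T c B hT h1 h2 w _)
        (norm_nonneg _) hB)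
      rw [norm_star]; exact hT i

lemma lsum_mul_left_real (p : ℕ) (a : ℝ) (f : List J → ℝ) :
    lsum p (fun w => a * f w) = a * lsum p f := by
  induction p generalizing f with
  | zero => rfl
  | succ p ih => simp only [lsum, ih, Finset.mul_sum]

lemma lsum_ch_le (c : J → J → ℝ) (B : ℝ) (hB : 0 ≤ B) (hc : ∀ i j, 0 ≤ c i j)
    (hs : ∀ i, ∑ j, c i j ≤ B) (p : ℕ) (i : J) :
    lsum p (fun w => ch c B (i :: w)) ≤ B ^ (p + 1) := by
  induction p generalizing i with
  | zero => simp [lsum, ch]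
  | succ p ih =>
    simp only [lsum, ch, lsum_mul_left_real]
    calc ∑ j, c i j * lsum p (fun w => ch c B (j :: w)) ≤ ∑ j, c i j * B ^ (p + 1) :=
          Finset.sum_le_sum fun j _ => mul_le_mul_of_nonneg_left (ih j) (hc i j)
      _ = (∑ j, c i j) * B ^ (p + 1) := by rw [Finset.sum_mul]
      _ ≤ B * B ^ (p + 1) := mul_le_mul_of_nonneg_right (hs i) (by positivity)
      _ = B ^ (p + 1 + 1) := by ring

lemma alt_two_mul (S : H →L[ℂ] H) (m : ℕ) : alt S true (2 * m) = (star S * S) ^ m := by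
  induction m with
  | zero => rfl
  | succ m ih =>
    rw [show 2 * (m + 1) = 2 * m + 1 + 1 by ring]
    simp only [alt, ih, pow_succ', mul_assoc]

/-- Finite Cotlar–Stein lemma. -/
theorem cotlar (T : J → H →L[ℂ] H) (c : J → J → ℝ) (B : ℝ) (hB : 0 ≤ B)
    (hc : ∀ i j, 0 ≤ c i j) 
    (h1 : ∀ i j, ‖star (T i) * T j‖ ≤ c i j ^ 2) (h2 : ∀ i j, ‖T i * star (T j)‖ ≤ c i j ^ 2)
    (hs : ∀ i, ∑ j, c i j ≤ B) : ‖∑ i, T i‖ ≤ B := by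
  have hT : ∀ i, ‖T i‖ ≤ B := fun i => by
    have h := h1 i i
    rw [CStarRing.norm_star_mul_self, ← sq] at h
    exact (le_of_sq_le_sq h (hc i i)).trans
      ((Finset.single_le_sum (fun j _ => hc i j) (Finset.mem_univ i)).trans (hs i))
  set S := ∑ i, T i with hS
  have key : ∀ k : ℕ, ‖S‖ ^ (2 * 2 ^ k) ≤ Fintype.card J * B ^ (2 * 2 ^ k) := by
    intro k
    have e1 : ‖S‖ ^ (2 * 2 ^ k) = ‖alt S true (2 * 2 ^ k)‖ := by
      rw [alt_two_mul, (IsSelfAdjoint.star_mul_self S).norm_pow_two_pow,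
        CStarRing.norm_star_mul_self, ← sq, ← pow_mul]
    rw [e1, hS, alt_eq]
    refine (lsum_norm_le _ _ (ch c B) fun w _ => word_le_ch T c B hB hc hT h1 h2 w _).trans ?_
    obtain ⟨p, hp⟩ : ∃ p, 2 * 2 ^ k = p + 1 := Nat.exists_eq_succ_of_ne_zero (by positivity)
    rw [hp]
    simp only [lsum]
    refine (Finset.sum_le_sum fun i _ => lsum_ch_le c B hB hc hs p i).trans ?_
    simp
  by_contra hlt
  push Not at hlt
  rcases hB.eq_or_lt with h0 | hpos
  · have := key 0
    rw [← h0] at this hlt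
    simp at this
    rw [this] at hlt
    simp at hlt
  · have hr : 1 < ‖S‖ / B := (one_lt_div hpos).2 hlt
    obtain ⟨m, hm⟩ := pow_unbounded_of_one_lt (Fintype.card J : ℝ) hr
    have h3 := key m
    have h4 : (‖S‖ / B) ^ (2 * 2 ^ m) ≤ Fintype.card J := by
      rw [div_pow, div_le_iff₀ (by positivity)]; exact h3
    have h5 : (‖S‖ / B) ^ m ≤ (‖S‖ / B) ^ (2 * 2 ^ m) :=
      pow_le_pow_right₀ hr.le (by have := Nat.lt_two_pow_self (n := m); omega)
    linarith

end Cotlar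


namespace Hadamard

variable {E : Type*} [NormedAddCommGroup E] [NormedSpace ℝ E]

theorem inj_of_local (F : E → E) (hF : Continuous F) (R κ ρ : ℝ) (hR : 0 < R) (hκ : 0 < κ)
    (hρ : 0 < ρ)
    (P1 : ∀ u v, dist u v ≤ R → κ * dist u v ≤ dist (F u) (F v))
    (P2 : ∀ y q, dist q (F y) ≤ ρ → ∃ y', F y' = q ∧ dist y' y ≤ R / 3) :
    Function.Injective F := by
  intro y0 y1 h01
  have P2' : ∀ y q, ∃ y', dist q (F y) ≤ ρ → F y' = q ∧ dist y' y ≤ R / 3 := by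
    intro y q
    by_cases h : dist q (F y) ≤ ρ
    · obtain ⟨y', h'⟩ := P2 y q h
      exact ⟨y', fun _ => h'⟩
    · exact ⟨y, fun h' => absurd h' h⟩
  choose N hN using P2'
  have P0 : ∀ u v, dist u v ≤ R → F u = F v → u = v := by
    intro u v h1 h2
    have := P1 u v h1
    rw [h2, dist_self] at this
    have h3 : dist u v ≤ 0 := by
      by_contra h; push Not at h
      have := mul_pos hκ h
      linarith
    exact dist_le_zero.1 h3
  set p := F y0 with hp
  let γ : unitInterval → E := fun t => AffineMap.lineMap y0 y1 (t : ℝ)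
  have hγ : Continuous γ := by
    simp only [γ, AffineMap.lineMap_apply_module]
    fun_prop
  obtain ⟨D, hD⟩ : ∃ D, ∀ t, dist (F (γ t)) p ≤ D := by
    have := isCompact_univ.bddAbove_image (f := fun t => dist (F (γ t)) p)
      (by fun_prop : Continuous fun t => dist (F (γ t)) p).continuousOn
    obtain ⟨D, hD⟩ := this
    exact ⟨D, fun t => hD ⟨t, trivial, rfl⟩⟩
  obtain ⟨m, hm⟩ := exists_nat_gt (D / ρ)
  have hm' : D ≤ m * ρ := by
    rw [div_lt_iff₀ hρ] at hm; exact hm.le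
  have hD0 : 0 ≤ D := dist_nonneg.trans (hD 0)
  have hm0 : (0 : ℝ) < m := lt_of_le_of_lt (by positivity) hm
  let q : ℕ → unitInterval → E := fun s t => F (γ t) + ((s : ℝ) / m) • (p - F (γ t))
  have hq : ∀ s, Continuous (q s) := fun s => by simp only [q]; fun_prop
  have hqs : ∀ s t, dist (q (s + 1) t) (q s t) ≤ ρ := by
    intro s t
    simp only [q, dist_add_left]
    rw [dist_eq_norm, ← sub_smul, norm_smul]
    have : ((s + 1 : ℕ) : ℝ) / m - s / m = 1 / m := by push_cast; field_simp; ring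
    rw [this, Real.norm_of_nonneg (by positivity), ← dist_eq_norm, dist_comm]
    calc 1 / (m : ℝ) * dist (F (γ t)) p ≤ 1 / m * (m * ρ) := by
          gcongr; exact (hD t).trans hm'
      _ = ρ := by field_simp
  obtain ⟨e, e0, es⟩ : ∃ e : ℕ → unitInterval → E, e 0 = γ ∧
      ∀ s t, e (s + 1) t = N (e s t) (q (s + 1) t) :=
    ⟨fun s => Nat.rec γ (fun s es t => N (es t) (q (s + 1) t)) s, rfl, fun s t => rfl⟩
  have hFe : ∀ s t, F (e s t) = q s t := by
    intro s t
    induction s with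
    | zero => simp [e0, q]
    | succ s ih =>
      rw [es]
      exact (hN _ _ (by rw [ih]; exact hqs s t)).1
  have hstep : ∀ s t, dist (e (s + 1) t) (e s t) ≤ R / 3 := by
    intro s t
    rw [es]
    exact (hN _ _ (by rw [hFe]; exact hqs s t)).2
  have hcont : ∀ s, Continuous (e s) := by
    intro s
    induction s with
    | zero => rw [e0]; exact hγ
    | succ s ih =>
      rw [continuous_iff_continuousAt]
      intro t
      rw [ContinuousAt, tendsto_iff_dist_tendsto_zero]
      have h1 : ∀ᶠ t' in nhds t, dist (e s t') (e s t) ≤ R / 3 := by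
        have := (ih.tendsto t) (Metric.closedBall_mem_nhds (e s t) (by positivity : 0 < R / 3))
        exact this
      have h2 : Filter.Tendsto (fun t' => κ⁻¹ * dist (q (s + 1) t') (q (s + 1) t)) (nhds t)
          (nhds 0) := by
        have := (tendsto_iff_dist_tendsto_zero.1 ((hq (s + 1)).tendsto t)).const_mul κ⁻¹
        simpa using this
      refine squeeze_zero' (Filter.Eventually.of_forall fun _ => dist_nonneg) ?_ h2
      filter_upwards [h1] with t' ht'
      have h3 : dist (e (s + 1) t') (e (s + 1) t) ≤ R := by
        have a1 := hstep s t'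
        have a2 := hstep s t
        have a3 := dist_triangle4 (e (s + 1) t') (e s t') (e s t) (e (s + 1) t)
        rw [dist_comm (e s t) (e (s + 1) t)] at a3
        linarith
      have h4 := P1 _ _ h3
      rw [hFe, hFe] at h4
      rw [inv_mul_eq_div, le_div_iff₀ hκ]
      linarith
  have hqm : ∀ t, q m t = p := fun t => by
    simp only [q]; rw [div_self hm0.ne']; simp
  have hlc : IsLocallyConstant (e m) := by
    rw [IsLocallyConstant.iff_eventually_eq]
    intro t
    have := ((hcont m).tendsto t) (Metric.closedBall_mem_nhds (e m t) hR)
    filter_upwards [this] with t' ht'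
    exact P0 _ _ ht' (by rw [hFe, hFe, hqm, hqm])
  have hend := hlc.apply_eq_of_preconnectedSpace 0 1
  have hfix : ∀ t, F (γ t) = p → ∀ s, e s t = γ t := by
    intro t ht s
    induction s with
    | zero => rw [e0]
    | succ s ih =>
      apply P0
      · have := hstep s t
        rw [ih] at this
        linarith
      · rw [hFe, ht]; simp [q, ht]
  have g0 : γ 0 = y0 := by simp [γ]
  have g1 : γ 1 = y1 := by simp [γ]
  rw [hfix 0 (by rw [g0]), hfix 1 (by rw [g1]; exact h01.symm), g0, g1] at hend
  exact hend

theorem lower_of_local (F : E → E) (hF : Continuous F) (R κ ρ : ℝ) (hR : 0 < R) (hκ : 0 < κ)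
    (hρ : 0 < ρ)
    (P1 : ∀ u v, dist u v ≤ R → κ * dist u v ≤ dist (F u) (F v))
    (P2 : ∀ y q, dist q (F y) ≤ ρ → ∃ y', F y' = q ∧ dist y' y ≤ R / 3) (u v : E) :
    κ * dist u v ≤ dist (F u) (F v) := by
  have hinj := inj_of_local F hF R κ ρ hR hκ hρ P1 P2
  set D := dist (F u) (F v) with hD
  obtain ⟨m, hm⟩ := exists_nat_gt (D / ρ)
  have hm' : D ≤ m * ρ := by
    rw [div_lt_iff₀ hρ] at hm; exact hm.le
  have hm0 : (0 : ℝ) < m := lt_of_le_of_lt (by positivity) hm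
  have key : ∀ s : ℕ, ∃ z, F z = F u + ((s : ℝ) / m) • (F v - F u) ∧ κ * dist u z ≤ s / m * D := by
    intro s
    induction s with
    | zero => exact ⟨u, by simp, by simp⟩
    | succ s ih =>
      obtain ⟨z, hz, hz'⟩ := ih
      have hd : dist (F u + (((s + 1 : ℕ) : ℝ) / m) • (F v - F u)) (F z) = 1 / m * D := by
        rw [hz, dist_add_left, dist_eq_norm, ← sub_smul, norm_smul]
        have : ((s + 1 : ℕ) : ℝ) / m - s / m = 1 / m := by push_cast; field_simp; ring
        rw [this, Real.norm_of_nonneg (by positivity), ← dist_eq_norm, dist_comm]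
      obtain ⟨z', h1, h2⟩ := P2 z (F u + (((s + 1 : ℕ) : ℝ) / m) • (F v - F u)) (by
        rw [hd, one_div, inv_mul_le_iff₀ hm0]; exact hm')
      refine ⟨z', h1, ?_⟩
      have h3 := P1 z' z (by linarith)
      rw [h1, hd] at h3
      have h4 := dist_triangle u z z'
      rw [dist_comm z z'] at h4
      have h5 : ((s + 1 : ℕ) : ℝ) / m * D = s / m * D + 1 / m * D := by push_cast; ring
      rw [h5]
      nlinarith
  obtain ⟨z, hz, hz'⟩ := key m
  rw [div_self hm0.ne', one_smul, add_sub_cancel] at hz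
  rw [div_self hm0.ne', one_mul, hinj hz] at hz'
  exact hz'

/-- Quantitative Hadamard global injectivity. -/
theorem lower_bound [FiniteDimensional ℝ E] (F : E → E) (F' : E → E →L[ℝ] E)
    (hF : ∀ y, HasFDerivAt F (F' y) y)
    (c L : ℝ) (hc : 0 < c) (hL : 0 < L) (hlow : ∀ y v, c * ‖v‖ ≤ ‖F' y v‖)
    (hlip : ∀ y w, ‖F' y - F' w‖ ≤ L * ‖y - w‖) (u v : E) :
    c / 2 * ‖u - v‖ ≤ ‖F u - F v‖ := by
  have hcont : Continuous F := continuous_iff_continuousAt.2 fun y => (hF y).continuousAt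
  have : CompleteSpace E := FiniteDimensional.complete ℝ E
  set R := c / (2 * L) with hRdef
  have hR : 0 < R := by positivity
  have happ : ∀ y, ApproximatesLinearOn F (F' y) (Metric.closedBall y R) (Real.toNNReal (c / 2)) := by
    have h4 : ((Real.toNNReal (c / 2)) : ℝ) = c / 2 := Real.coe_toNNReal _ (by positivity)
    intro y a ha b hb
    rw [h4]
    refine Convex.norm_image_sub_le_of_norm_hasFDerivWithin_le' (f' := F')
      (fun x hx => (hF x).hasFDerivWithinAt) (fun x hx => ?_) (convex_closedBall y R) hb ha
    refine (hlip x y).trans ?_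
    have : ‖x - y‖ ≤ R := by simpa [dist_eq_norm] using hx
    calc L * ‖x - y‖ ≤ L * R := by gcongr
      _ = c / 2 := by rw [hRdef]; field_simp
  have := lower_of_local F hcont R (c / 2) (c / 2 * (R / 3)) hR (by positivity) (by positivity)
    (fun u v huv => ?_) (fun y q hq => ?_) u v
  · simpa [dist_eq_norm] using this
  · have h1 := happ v u (by simpa using huv) v (by simp [hR.le])
    have h2 := hlow v (u - v)
    have h3 := norm_sub_norm_le (F' v (u - v)) (F u - F v)
    rw [norm_sub_rev (F' v (u - v))] at h3
    rw [dist_eq_norm, dist_eq_norm]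
    have h4 : ((Real.toNNReal (c / 2)) : ℝ) = c / 2 := Real.coe_toNNReal _ (by positivity)
    rw [h4] at h1
    linarith
  · have hker : Function.Injective (F' y) := by
      intro a b hab
      have := hlow y (a - b)
      rw [map_sub, hab, sub_self, norm_zero] at this
      have h0 : ‖a - b‖ ≤ 0 := by
        by_contra h; push Not at h
        have := mul_pos hc h
        linarith
      exact sub_eq_zero.1 (norm_le_zero_iff.1 h0)
    have hsurj : Function.Surjective (F' y) :=
      LinearMap.surjective_of_injective (f := (F' y).toLinearMap) hker
    choose g hg using hsurj
    let G : (F' y).NonlinearRightInverse :=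
      { toFun := g
        nnnorm := ⟨c⁻¹, by positivity⟩
        bound' := fun z => by
          have := hlow y (g z)
          rw [hg] at this
          show ‖g z‖ ≤ c⁻¹ * ‖z‖
          rw [inv_mul_eq_div, le_div_iff₀ hc]
          linarith
        right_inv' := hg }
    have hs := (happ y).surjOn_closedBall_of_nonlinearRightInverse G
      (ε := R / 3) (b := y) (by positivity) (Metric.closedBall_subset_closedBall (by linarith))
    have h4 : ((Real.toNNReal (c / 2)) : ℝ) = c / 2 := Real.coe_toNNReal _ (by positivity)
    have h5 : (G.nnnorm : ℝ) = c⁻¹ := rfl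
    rw [h4, h5, inv_inv] at hs
    obtain ⟨y', hy', h'⟩ := hs (a := q) (by
      rw [Metric.mem_closedBall]; refine hq.trans (le_of_eq (by ring)))
    exact ⟨y', h', hy'⟩

end Hadamard


namespace OscInt

section calcs
variable {W F G : Type*} [NormedAddCommGroup W] [NormedSpace ℝ W]
    [NormedAddCommGroup F] [NormedSpace ℝ F] [NormedAddCommGroup G] [NormedSpace ℝ G]

/-- Smoothness. -/
abbrev Sm (g : W → F) : Prop := ContDiff ℝ (⊤ : ℕ∞) g

lemma Sm.diff {g : W → F} (hg : Sm g) : Differentiable ℝ g := hg.differentiable (by simp)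

lemma Sm.dLine {g : W → F} (hg : Sm g) (v : W) : Sm (dLine v g) := by
  unfold _root_.dLine
  have : Sm (fderiv ℝ g) := hg.fderiv_right (by simp)
  exact this.clm_apply contDiff_const

lemma dLine_comm {g : W → F} (hg : Sm g) (v w : W) :
    dLine v (dLine w g) = dLine w (dLine v g) := by
  ext z
  have h2 : Differentiable ℝ (fderiv ℝ g) :=
    (hg.fderiv_right (m := (⊤ : ℕ∞)) (by simp)).differentiable (by simp)
  have key : ∀ a b : W, dLine a (dLine b g) z = fderiv ℝ (fderiv ℝ g) z a b := by
    intro a b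
    unfold _root_.dLine
    rw [fderiv_clm_apply (h2 z) (differentiableAt_const _)]
    simp
  rw [key, key]
  have hs : IsSymmSndFDerivAt ℝ g z := by
    apply (hg.contDiffAt (x := z)).isSymmSndFDerivAt
    simp only [minSmoothness_of_isRCLikeNormedField]
    exact WithTop.coe_le_coe.2 (le_top : (2 : ℕ∞) ≤ ⊤)
  exact hs v w

lemma Sm.iter {g : W → F} (hg : Sm g) (v : W) (k : ℕ) : Sm ((_root_.dLine v)^[k] g) := by
  induction k with
  | zero => exact hg
  | succ k ih => rw [Function.iterate_succ_apply']; exact ih.dLine v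

lemma dLine_iter_comm {g : W → F} (hg : Sm g) (v w : W) (k : ℕ) :
    dLine w ((dLine v)^[k] g) = (dLine v)^[k] (dLine w g) := by
  induction k with
  | zero => rfl
  | succ k ih =>
    rw [Function.iterate_succ_apply', Function.iterate_succ_apply', ← ih, dLine_comm (hg.iter v k)]

lemma mderiv_succ {n : ℕ} (dirs : Fin (n + 1) → W) (α : Fin (n + 1) → ℕ) (g : W → F) :
    mderiv dirs α g = (dLine (dirs 0))^[α 0]
      (mderiv (fun i => dirs i.succ) (fun i => α i.succ) g) := by
  simp only [mderiv, List.ofFn_succ, List.foldr_cons, Function.comp_apply]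

lemma mderiv_zero {n : ℕ} (dirs : Fin n → W) (g : W → F) : mderiv dirs 0 g = g := by
  induction n with
  | zero => simp [mderiv]
  | succ n ih =>
    rw [mderiv_succ]
    exact ih (fun i => dirs i.succ)

lemma Sm.mderiv {n : ℕ} (dirs : Fin n → W) (α : Fin n → ℕ) {g : W → F} (hg : Sm g) :
    Sm (mderiv dirs α g) := by
  induction n with
  | zero => simpa [_root_.mderiv] using hg
  | succ n ih =>
    rw [mderiv_succ]
    exact (ih _ _).iter _ _

lemma dLine_mderiv {n : ℕ} (dirs : Fin n → W) (α : Fin n → ℕ) {g : W → F} (hg : Sm g) (i : Fin n) :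
    dLine (dirs i) (mderiv dirs α g) = mderiv dirs (α + Pi.single i 1) g := by
  induction n with
  | zero => exact i.elim0
  | succ n ih =>
    rw [mderiv_succ, mderiv_succ]
    refine Fin.cases ?_ (fun j => ?_) i
    · rw [← Function.iterate_succ_apply' (dLine (dirs 0))]
      congr 1
    · rw [dLine_iter_comm (hg.mderiv _ _), ih (fun i => dirs i.succ) (fun i => α i.succ) j]
      have h1 : (α + Pi.single (M := fun _ => ℕ) j.succ 1 : Fin (n + 1) → ℕ) 0 = α 0 := by simp
      have h2 : ((fun i : Fin n => α i.succ) + Pi.single j 1) =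
          (fun i : Fin n => (α + Pi.single (M := fun _ => ℕ) j.succ 1 : Fin (n + 1) → ℕ) i.succ) := by
        ext k
        simp [Pi.single_apply, Fin.succ_inj]
      rw [h1, h2]

lemma mderiv_smul {n : ℕ} (dirs : Fin n → W) (α : Fin n → ℕ) {g : W → ℂ} (hg : Sm g) (c : ℝ) :
    mderiv dirs α (fun z => (c : ℂ) * g z) = fun z => (c : ℂ) * mderiv dirs α g z := by
  have h1 : ∀ (v : W) (f : W → ℂ), Sm f → 
      dLine v (fun z => (c : ℂ) * f z) = fun z => (c : ℂ) * dLine v f z := by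
    intro v f hf
    ext z
    simp only [_root_.dLine]
    rw [fderiv_const_mul (hf.diff z)]
    simp
  have h2 : ∀ (v : W) (k : ℕ) (f : W → ℂ), Sm f → 
      (dLine v)^[k] (fun z => (c : ℂ) * f z) = fun z => (c : ℂ) * (dLine v)^[k] f z := by
    intro v k f hf
    induction k with
    | zero => rfl
    | succ k ih => rw [Function.iterate_succ_apply', ih, h1 _ _ (hf.iter v k),
        Function.iterate_succ_apply']
  induction n with
  | zero => simp [_root_.mderiv]
  | succ n ih =>
    rw [mderiv_succ, ih, h2 _ _ _ (hg.mderiv _ _), mderiv_succ]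

/-- All derivatives along the directions `e` of order at most `k` are bounded by `M`. -/
def PB {n : ℕ} (e : Fin n → W) : ℕ → ℝ → (W → F) → Prop
  | 0, M, f => ∀ x, ‖f x‖ ≤ M
  | k + 1, M, f => (∀ x, ‖f x‖ ≤ M) ∧ ∀ i, PB e k M (dLine (e i) f)

variable {n : ℕ} {e : Fin n → W}

lemma PB.bound {k : ℕ} {M : ℝ} {f : W → F} (h : PB e k M f) (x : W) : ‖f x‖ ≤ M := by
  cases k with
  | zero => exact h x
  | succ k => exact h.1 x

lemma PB.mono {k : ℕ} {M M' : ℝ} {f : W → F} (h : PB e k M f) (hM : M ≤ M') : PB e k M' f := by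
  induction k generalizing f with
  | zero => exact fun x => (h x).trans hM
  | succ k ih => exact ⟨fun x => (h.1 x).trans hM, fun i => ih (h.2 i)⟩

lemma PB.of_succ {k : ℕ} {M : ℝ} {f : W → F} (h : PB e (k + 1) M f) : PB e k M f := by
  induction k generalizing f with
  | zero => exact h.1
  | succ k ih => exact ⟨h.1, fun i => ih (h.2 i)⟩

lemma PB.le {k k' : ℕ} {M : ℝ} {f : W → F} (h : PB e k M f) (hk : k' ≤ k) : PB e k' M f := by
  induction k with
  | zero => obtain rfl : k' = 0 := by omega
            exact h
  | succ k ih =>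
    rcases Nat.lt_or_ge k k' with h1 | h1
    · obtain rfl : k' = k + 1 := by omega
      exact h
    · exact ih h.of_succ h1

lemma PB_of_mderiv {g : W → F} (hg : Sm g) (K : ℕ) (M : ℝ)
    (h : ∀ α, mdeg α ≤ K → ∀ z, ‖mderiv e α g z‖ ≤ M) : PB e K M g := by
  have key : ∀ k α, mdeg α + k ≤ K → PB e k M (mderiv e α g) := by
    intro k
    induction k with
    | zero => exact fun α hα => h α hα
    | succ k ih =>
      intro α hα
      refine ⟨h α (by omega), fun i => ?_⟩
      rw [dLine_mderiv _ _ hg]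
      apply ih
      have : mdeg (α + Pi.single i 1) = mdeg α + 1 := by
        simp [mdeg, Finset.sum_add_distrib, Finset.sum_pi_single']
      omega
  have := key K 0 (by simp [mdeg])
  rwa [mderiv_zero] at this

lemma dLine_add {f g : W → F} (hf : Sm f) (hg : Sm g) (v : W) :
    dLine v (fun x => f x + g x) = fun x => dLine v f x + dLine v g x := by
  ext x
  simp only [_root_.dLine]
  rw [fderiv_fun_add (hf.diff x) (hg.diff x)]; rfl

lemma dLine_mul {f g : W → ℂ} (hf : Sm f) (hg : Sm g) (v : W) :
    dLine v (fun x => f x * g x) = fun x => f x * dLine v g x + dLine v f x * g x := by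
  ext x
  simp only [_root_.dLine]
  rw [fderiv_fun_mul (hf.diff x) (hg.diff x)]
  simp [mul_comm]

lemma dLine_clm {f : W → F} (hf : Sm f) (L : F →L[ℝ] G) (v : W) :
    dLine v (fun x => L (f x)) = fun x => L (dLine v f x) := by
  ext x
  simp only [_root_.dLine]
  have : HasFDerivAt (fun x => L (f x)) (L.comp (fderiv ℝ f x)) x :=
    L.hasFDerivAt.comp x (hf.diff x).hasFDerivAt
  rw [this.fderiv]; rfl

lemma PB.add {k : ℕ} {M M' : ℝ} {f g : W → F} (hf : Sm f) (hg : Sm g) (h : PB e k M f)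
    (h' : PB e k M' g) : PB e k (M + M') (fun x => f x + g x) := by
  induction k generalizing f g with
  | zero => exact fun x => (norm_add_le _ _).trans (add_le_add (h x) (h' x))
  | succ k ih =>
    refine ⟨fun x => (norm_add_le _ _).trans (add_le_add (h.1 x) (h'.1 x)), fun i => ?_⟩
    rw [dLine_add hf hg]
    exact ih (hf.dLine _) (hg.dLine _) (h.2 i) (h'.2 i)

lemma PB.clm {k : ℕ} {M : ℝ} {f : W → F} (hf : Sm f) (L : F →L[ℝ] G) (hL : ∀ z, ‖L z‖ ≤ ‖z‖)
    (h : PB e k M f) : PB e k M (fun x => L (f x)) := by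
  induction k generalizing f with
  | zero => exact fun x => (hL _).trans (h x)
  | succ k ih =>
    refine ⟨fun x => (hL _).trans (h.1 x), fun i => ?_⟩
    rw [dLine_clm hf]
    exact ih (hf.dLine _) (h.2 i)

lemma PB.nonneg {k : ℕ} {M : ℝ} {f : W → F} (h : PB e k M f) : 0 ≤ M :=
  (norm_nonneg _).trans (h.bound 0)

lemma PB.mul {k : ℕ} {M M' : ℝ} {f g : W → ℂ} (hf : Sm f) (hg : Sm g) (h : PB e k M f)
    (h' : PB e k M' g) : PB e k (2 ^ k * (M * M')) (fun x => f x * g x) := by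
  have hM := h.nonneg
  have hM' := h'.nonneg
  have h0 : ∀ x, ‖f x * g x‖ ≤ M * M' := fun x => by
    rw [norm_mul]; exact mul_le_mul (h.bound x) (h'.bound x) (norm_nonneg _) hM
  induction k generalizing f g with
  | zero => intro x; simpa using h0 x
  | succ k ih =>
    refine ⟨fun x => (h0 x).trans ?_, fun i => ?_⟩
    · exact le_mul_of_one_le_left (by positivity) (one_le_pow₀ (by norm_num))
    rw [dLine_mul hf hg]
    have a1 := ih hf (hg.dLine (e i)) h.of_succ (h'.2 i) (fun x => by
      rw [norm_mul]; exact mul_le_mul (h.bound x) ((h'.2 i).bound x) (norm_nonneg _) hM)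
    have a2 := ih (hf.dLine (e i)) hg (h.2 i) h'.of_succ (fun x => by
      rw [norm_mul]; exact mul_le_mul ((h.2 i).bound x) (h'.bound x) (norm_nonneg _) hM)
    have := PB.add (hf.mul (hg.dLine (e i))) ((hf.dLine (e i)).mul hg) a1 a2
    refine this.mono (le_of_eq (by ring))

end calcs

section fam
variable {W F G : Type*} [NormedAddCommGroup W] [NormedSpace ℝ W]
    [NormedAddCommGroup F] [NormedSpace ℝ F] [NormedAddCommGroup G] [NormedSpace ℝ G]
    {n : ℕ} {e : Fin n → W} {ι : Type*}

/-- A family of smooth functions with uniformly bounded derivatives up to order `k`. -/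
def UB (e : Fin n → W) (k : ℕ) (f : ι → W → F) : Prop :=
  (∀ i, Sm (f i)) ∧ ∃ M, ∀ i, PB e k M (f i)

lemma UB.le {k k' : ℕ} {f : ι → W → F} (h : UB e k f) (hk : k' ≤ k) : UB e k' f :=
  ⟨h.1, h.2.imp fun M hM i => (hM i).le hk⟩

lemma UB.add {k : ℕ} {f g : ι → W → F} (hf : UB e k f) (hg : UB e k g) :
    UB e k (fun i x => f i x + g i x) := by
  obtain ⟨h1, M1, h1'⟩ := hf
  obtain ⟨h2, M2, h2'⟩ := hg
  exact ⟨fun i => (h1 i).add (h2 i), M1 + M2, fun i => (h1' i).add (h1 i) (h2 i) (h2' i)⟩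

lemma UB.mul {k : ℕ} {f g : ι → W → ℂ} (hf : UB e k f) (hg : UB e k g) :
    UB e k (fun i x => f i x * g i x) := by
  obtain ⟨h1, M1, h1'⟩ := hf
  obtain ⟨h2, M2, h2'⟩ := hg
  exact ⟨fun i => (h1 i).mul (h2 i), _, fun i => (h1' i).mul (h1 i) (h2 i) (h2' i)⟩

lemma UB.clm {k : ℕ} {f : ι → W → F} (hf : UB e k f) (L : F →L[ℝ] G) (hL : ∀ z, ‖L z‖ ≤ ‖z‖) :
    UB e k (fun i x => L (f i x)) := by
  obtain ⟨h1, M1, h1'⟩ := hf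
  exact ⟨fun i => L.contDiff.comp (h1 i), _, fun i => (h1' i).clm (h1 i) L hL⟩

lemma UB.const {k : ℕ} (c : ℂ) : UB e k (fun (_ : ι) (_ : W) => c) := by
  refine ⟨fun i => contDiff_const, ‖c‖, fun i => ?_⟩
  have : ∀ k (c' : ℂ), ‖c'‖ ≤ ‖c‖ → PB e k ‖c‖ (fun _ : W => c') := by
    intro k
    induction k with
    | zero => exact fun c' h x => h
    | succ k ih =>
      refine fun c' h => ⟨fun x => h, fun i => ?_⟩
      have : dLine (e i) (fun _ : W => c') = fun _ => 0 := by
        ext x; simp [_root_.dLine]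
      rw [this]
      exact ih 0 (by simp)
  exact this k c le_rfl

lemma UB.sum {k : ℕ} {m : Type*} (s : Finset m) {f : m → ι → W → ℂ} (hf : ∀ j, UB e k (f j)) :
    UB e k (fun i x => ∑ j ∈ s, f j i x) := by
  classical
  induction s using Finset.induction_on with
  | empty => simpa using UB.const (e := e) (ι := ι) (k := k) 0
  | insert a s ha ih =>
    simp only [Finset.sum_insert ha]
    exact (hf a).add ih

lemma UB.dLine {k : ℕ} {f : ι → W → F} (hf : UB e (k + 1) f) (j : Fin n) :
    UB e k (fun i => dLine (e j) (f i)) :=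
  ⟨fun i => (hf.1 i).dLine _, hf.2.imp fun M hM i => (hM i).2 j⟩

lemma UB.of_succ {k : ℕ} {f : ι → W → F} (hs : ∀ i, Sm (f i)) (hb : ∃ M, ∀ i x, ‖f i x‖ ≤ M)
    (hd : ∀ j, UB e k (fun i => _root_.dLine (e j) (f i))) : UB e (k + 1) f := by
  refine ⟨hs, ?_⟩
  obtain ⟨M, hM⟩ := hb
  choose M' hM' using fun j => (hd j).2
  refine ⟨|M| + ∑ j, |M' j|, fun i => ⟨fun x => (hM i x).trans ?_, fun j => (hM' j i).mono ?_⟩⟩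
  · have : 0 ≤ ∑ j, |M' j| := Finset.sum_nonneg fun j _ => abs_nonneg _
    linarith [le_abs_self M]
  · have : |M' j| ≤ ∑ j, |M' j| :=
      Finset.single_le_sum (f := fun j => |M' j|) (fun j _ => abs_nonneg _) (Finset.mem_univ j)
    linarith [le_abs_self (M' j), abs_nonneg M]

lemma dLine_inv {f : W → ℂ} (hf : Sm f) (h0 : ∀ x, f x ≠ 0) (v : W) :
    dLine v (fun x => (f x)⁻¹) = fun x => (-1) * (dLine v f x * ((f x)⁻¹ * (f x)⁻¹)) := by
  ext x
  simp only [_root_.dLine]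
  have h2 := (hasDerivAt_inv (h0 x)).comp_hasFDerivAt_of_eq x ((hf.diff x).hasFDerivAt) rfl
  have h3 : HasFDerivAt (fun x => (f x)⁻¹) _ x := h2
  rw [h3.fderiv]
  have := h0 x
  simp
  field_simp

lemma UB.inv {k : ℕ} {f : ι → W → ℂ} (hf : UB e k f) (c : ℝ) (hc : 0 < c)
    (hl : ∀ i x, c ≤ ‖f i x‖) : UB e k (fun i x => (f i x)⁻¹) := by
  have h0 : ∀ i x, f i x ≠ 0 := fun i x h => by
    have := hl i x
    rw [h, norm_zero] at this
    linarith
  have hs : ∀ i, Sm (fun x => (f i x)⁻¹) := fun i => (hf.1 i).inv (h0 i)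
  have hb : ∀ i x, ‖(f i x)⁻¹‖ ≤ c⁻¹ := fun i x => by
    rw [norm_inv]; exact inv_anti₀ hc (hl i x)
  induction k with
  | zero => exact ⟨hs, c⁻¹, fun i x => hb i x⟩
  | succ k ih =>
    refine UB.of_succ hs ⟨c⁻¹, hb⟩ fun j => ?_
    simp only [dLine_inv (hf.1 _) (h0 _)]
    have a := ih (hf.le (by omega))
    exact (UB.const (-1)).mul ((hf.dLine j).mul (a.mul a))

end fam
end OscInt


namespace OscInt

/-- Coordinate directions. -/
def eb {n : ℕ} (i : Fin n) : EuclideanSpace ℝ (Fin n) := EuclideanSpace.single i 1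

section ibp
variable {n : ℕ}

local notation "E" => EuclideanSpace ℝ (Fin n)

/-- The transposed operator. -/
def Dop (V : Fin n → E → ℂ) (f : E → ℂ) : E → ℂ :=
  fun x => ∑ i, dLine (eb i) (fun x => V i x * f x) x

lemma Dop_smooth {V : Fin n → E → ℂ} (hV : ∀ i, Sm (V i)) {f : E → ℂ} (hf : Sm f) :
    Sm (Dop V f) := by
  unfold Dop
  exact ContDiff.sum fun i _ => Sm.dLine ((hV i).mul hf) _

lemma dLine_zero_off {S : Set E} (hS : IsClosed S) {f : E → ℂ} (h0 : ∀ x, x ∉ S → f x = 0)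
    (v : E) (x : E) (hx : x ∉ S) : dLine v f x = 0 := by
  have : f =ᶠ[nhds x] fun _ => 0 := by
    filter_upwards [hS.isOpen_compl.mem_nhds hx] with y hy
    exact h0 y hy
  simp [dLine, this.fderiv_eq]

lemma Dop_zero_off {S : Set E} (hS : IsClosed S) {V : Fin n → E → ℂ} {f : E → ℂ}
    (h0 : ∀ x, x ∉ S → f x = 0) (x : E) (hx : x ∉ S) : Dop V f x = 0 := by
  unfold Dop
  exact Finset.sum_eq_zero fun i _ =>
    dLine_zero_off hS (fun y hy => by simp [h0 y hy]) _ x hx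

lemma integrable_of_zero_off {S : Set E} (hS : IsCompact S) {f : E → ℂ} (hf : Continuous f)
    (h0 : ∀ x, x ∉ S → f x = 0) : Integrable f :=
  hf.integrable_of_hasCompactSupport (HasCompactSupport.intro hS h0)

lemma ibp_step {S : Set E} (hS : IsCompact S) {ψ : E → ℝ} (hψ : Sm ψ) {V : Fin n → E → ℂ}
    (hV : ∀ i, Sm (V i)) {f : E → ℂ} (hf : Sm f) (h0 : ∀ x, x ∉ S → f x = 0) (lam : ℝ)
    (hlam : ∀ x, ∑ i, V i x * ((dLine (eb i) ψ x : ℝ) : ℂ) = lam) :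
    (I * lam) * ∫ x, cexp (I * ψ x) * f x = - ∫ x, cexp (I * ψ x) * Dop V f x := by
  set ex : E → ℂ := fun x => cexp (I * ψ x) with hex
  have hψc : Sm (fun x => I * (ψ x : ℂ)) := contDiff_const.mul (ofRealCLM.contDiff.comp hψ)
  have hexs : Sm ex := hψc.cexp
  have hdex : ∀ v x, dLine v ex x = ex x * (I * ((dLine v ψ x : ℝ) : ℂ)) := by
    intro v x
    have h1 : HasFDerivAt (fun x => I * (ψ x : ℂ)) (I • (ofRealCLM.comp (fderiv ℝ ψ x))) x :=
      (ofRealCLM.hasFDerivAt.comp x (hψ.diff x).hasFDerivAt).const_mul I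
    have h2 := h1.cexp
    simp only [dLine, hex]
    rw [h2.fderiv]
    simp
  have hVf : ∀ i, Sm (fun x => V i x * f x) := fun i => (hV i).mul hf
  have hVf0 : ∀ i x, x ∉ S → V i x * f x = 0 := fun i x hx => by simp [h0 x hx]
  have hpart : ∀ i, ∫ x, ex x * dLine (eb i) (fun x => V i x * f x) x =
      - ∫ x, dLine (eb i) ex x * (V i x * f x) := by
    intro i
    apply integral_mul_fderiv_eq_neg_fderiv_mul_of_integrable
    · exact integrable_of_zero_off hS ((hexs.dLine (eb i)).continuous.mul (hVf i).continuous)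
        fun x hx => by simp [h0 x hx]
    · refine integrable_of_zero_off hS (hexs.continuous.mul ((hVf i).dLine (eb i)).continuous)
        fun x hx => ?_
      have := dLine_zero_off hS.isClosed (hVf0 i) (eb i) x hx
      simp only [dLine] at this
      simp [this]
    · exact integrable_of_zero_off hS (hexs.continuous.mul (hVf i).continuous)
        fun x hx => by simp [h0 x hx]
    · exact fun x _ => hexs.diff x
    · exact fun x _ => (hVf i).diff x
  have e1 : ∫ x, ex x * Dop V f x = ∑ i, ∫ x, ex x * dLine (eb i) (fun x => V i x * f x) x := by
    rw [← integral_finsetSum]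
    · simp only [Dop, Finset.mul_sum]
    · intro i _
      exact integrable_of_zero_off hS (hexs.continuous.mul ((hVf i).dLine (eb i)).continuous)
        fun x hx => by simp [dLine_zero_off hS.isClosed (hVf0 i) (eb i) x hx]
  rw [e1]
  simp only [hpart]
  rw [Finset.sum_neg_distrib, neg_neg, ← integral_finsetSum, ← integral_const_mul]
  · congr 1
    ext x
    simp only [hdex]
    have := hlam x
    rw [← this, Finset.mul_sum, Finset.sum_mul]
    refine Finset.sum_congr rfl fun i _ => ?_
    ring
  · intro i _
    exact integrable_of_zero_off hS ((hexs.dLine (eb i)).continuous.mul (hVf i).continuous)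
        fun x hx => by simp [h0 x hx]

lemma ibp_iter {S : Set E} (hS : IsCompact S) {ψ : E → ℝ} (hψ : Sm ψ) {V : Fin n → E → ℂ}
    (hV : ∀ i, Sm (V i)) (lam : ℝ)
    (hlam : ∀ x, ∑ i, V i x * ((dLine (eb i) ψ x : ℝ) : ℂ) = lam) (N : ℕ) 
    {f : E → ℂ} (hf : Sm f) (h0 : ∀ x, x ∉ S → f x = 0) :
    ‖∫ x, cexp (I * ψ x) * f x‖ * |lam| ^ N = ‖∫ x, cexp (I * ψ x) * ((Dop V)^[N] f) x‖ := by
  induction N generalizing f with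
  | zero => simp
  | succ N ih =>
    rw [Function.iterate_succ_apply, ← ih (Dop_smooth hV hf) (Dop_zero_off hS.isClosed h0),
      pow_succ', ← mul_assoc]
    congr 1
    have := congrArg norm (ibp_step hS hψ hV hf h0 lam hlam)
    rw [norm_neg, norm_mul, norm_mul, norm_I, one_mul, norm_real, Real.norm_eq_abs] at this
    rw [← this, mul_comm]

theorem osc_decay {ι : Type*} (ψ : ι → E → ℝ) (f : ι → E → ℂ) (lam : ι → ℝ) (S : ι → Set E)
    (N : ℕ) (c Vol : ℝ) (hc : 0 < c) (hψ : ∀ i, Sm (ψ i)) (hlam : ∀ i, 0 < lam i)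
    (hg : ∀ j, UB eb N (fun i x => ((dLine (eb j) (ψ i) x / lam i : ℝ) : ℂ)))
    (hlow : ∀ i x, c ≤ ∑ j, (dLine (eb j) (ψ i) x / lam i) ^ 2)
    (hf : UB eb N f) (hS : ∀ i, IsCompact (S i)) (hVol : ∀ i, volume.real (S i) ≤ Vol)
    (h0 : ∀ i x, x ∉ S i → f i x = 0) :
    ∃ C, ∀ i, ‖∫ x, cexp (I * ψ i x) * f i x‖ * lam i ^ N ≤ C := by
  set g : Fin n → ι → E → ℂ := fun j i x => ((dLine (eb j) (ψ i) x / lam i : ℝ) : ℂ) with hgdef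
  set q : ι → E → ℂ := fun i x => ∑ j, g j i x * g j i x with hq
  have hqUB : UB eb N q := UB.sum _ fun j => (hg j).mul (hg j)
  have hqe : ∀ i x, q i x = ((∑ j, (dLine (eb j) (ψ i) x / lam i) ^ 2 : ℝ) : ℂ) := by
    intro i x
    simp only [hq, hgdef]
    push_cast
    exact Finset.sum_congr rfl fun j _ => by ring
  have hqn : ∀ i x, c ≤ ‖q i x‖ := by
    intro i x
    rw [hqe, norm_real]
    exact (hlow i x).trans (le_abs_self _)
  have hq0 : ∀ i x, q i x ≠ 0 := fun i x h => by
    have := hqn i x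
    rw [h, norm_zero] at this
    linarith
  have hqi := hqUB.inv c hc hqn
  set V : ι → Fin n → E → ℂ := fun i j x => g j i x * (q i x)⁻¹ with hVdef
  have hV : ∀ j, UB eb N (fun i => V i j) := fun j => (hg j).mul hqi
  have hVs : ∀ i j, Sm (V i j) := fun i j => (hV j).1 i
  have hVl : ∀ i x, ∑ j, V i j x * ((dLine (eb j) (ψ i) x : ℝ) : ℂ) = lam i := by
    intro i x
    have h1 : ∀ j, V i j x * ((dLine (eb j) (ψ i) x : ℝ) : ℂ) = lam i * (q i x)⁻¹ * (g j i x * g j i x) := by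
      intro j
      have : ((dLine (eb j) (ψ i) x : ℝ) : ℂ) = lam i * g j i x := by
        simp only [hgdef]
        rw [← ofReal_mul, mul_div_cancel₀ _ (hlam i).ne']
      rw [this]
      simp only [hVdef]
      ring
    simp only [h1]
    rw [← Finset.mul_sum]
    show _ * q i x = _
    rw [mul_assoc, inv_mul_cancel₀ (hq0 i x), mul_one]
  have hD : ∀ k m, k + m = N → UB eb k (fun i => (Dop (V i))^[m] (f i)) := by
    intro k m
    induction m generalizing k with
    | zero => intro h; simpa [← h] using hf
    | succ m ih =>
      intro h
      have := ih (k + 1) (by omega)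
      simp only [Function.iterate_succ_apply']
      unfold Dop
      apply UB.sum
      intro j
      exact (((hV j).le (by omega : k + 1 ≤ N)).mul this).dLine j
  obtain ⟨_, M, hM⟩ := hD 0 N (by omega)
  refine ⟨|M| * Vol, fun i => ?_⟩
  have h1 := ibp_iter (hS i) (hψ i) (hVs i) (lam i) (hVl i) N (hf.1 i) (h0 i)
  rw [abs_of_pos (hlam i)] at h1
  rw [h1]
  have hz : ∀ m x, x ∉ S i → ((Dop (V i))^[m] (f i)) x = 0 := by
    intro m
    induction m with
    | zero => exact h0 i
    | succ m ih =>
      rw [Function.iterate_succ_apply']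
      exact Dop_zero_off (hS i).isClosed ih
  rw [← setIntegral_eq_integral_of_forall_compl_eq_zero (s := S i) (fun x hx => by rw [hz N x hx, mul_zero])]
  refine (norm_setIntegral_le_of_norm_le_const (hS i).measure_lt_top (C := |M|) fun x _ => ?_).trans ?_
  · rw [norm_mul, mul_comm I, norm_exp_ofReal_mul_I, one_mul]
    exact (hM i x).trans (le_abs_self M)
  · exact mul_le_mul_of_nonneg_left (hVol i) (abs_nonneg _)

end ibp
end OscInt


namespace OscInt

section phase
variable {n : ℕ}

local notation "E" => EuclideanSpace ℝ (Fin n)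

lemma coord_le (v : E) (i : Fin n) : |v i| ≤ ‖v‖ := by
  simpa using PiLp.norm_apply_le v i

lemma norm_le_sum (v : E) : ‖v‖ ≤ ∑ i, |v i| := by
  have h : v = ∑ i, (v i) • (EuclideanSpace.single i (1:ℝ) : E) := by
    ext j
    simp [Finset.sum_apply, Pi.single_apply]
  calc ‖v‖ = ‖∑ i, (v i) • (EuclideanSpace.single i (1:ℝ) : E)‖ := by rw [← h]
    _ ≤ ∑ i, ‖(v i) • (EuclideanSpace.single i (1:ℝ) : E)‖ := norm_sum_le _ _
    _ = _ := by simp [norm_smul]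

lemma vec_sum (v : E) : v = ∑ i, (v i) • (eb i : E) := by
  ext j
  simp [Finset.sum_apply, Pi.single_apply, eb]

section slices
variable {F : Type*} [NormedAddCommGroup F] [NormedSpace ℝ F]

lemma fderiv_sliceX {h : E × E → F} (hh : Sm h) (x y v : E) :
    fderiv ℝ (fun x => h (x, y)) x v = fderiv ℝ h (x, y) (v, 0) := by
  have h1 : HasFDerivAt (fun x : E => (x, y)) (ContinuousLinearMap.inl ℝ E E) x :=
    hasFDerivAt_prodMk_left x y
  have := ((hh.diff (x, y)).hasFDerivAt.comp x h1).fderiv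
  have h2 : (h ∘ fun x : E => (x, y)) = fun x => h (x, y) := rfl
  rw [h2] at this
  rw [this]; simp

lemma fderiv_sliceY {h : E × E → F} (hh : Sm h) (x y v : E) :
    fderiv ℝ (fun y => h (x, y)) y v = fderiv ℝ h (x, y) (0, v) := by
  have h1 : HasFDerivAt (fun y : E => (x, y)) (ContinuousLinearMap.inr ℝ E E) y :=
    hasFDerivAt_prodMk_right x y
  have := ((hh.diff (x, y)).hasFDerivAt.comp y h1).fderiv
  have h2 : (h ∘ fun y : E => (x, y)) = fun y => h (x, y) := rfl
  rw [h2] at this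
  rw [this]; simp

lemma dLine_sliceX {h : E × E → F} (hh : Sm h) (i : Fin n) (y : E) :
    dLine (eb i) (fun x => h (x, y)) = fun x => dLine (dX i) h (x, y) := by
  ext x
  exact fderiv_sliceX hh x y _

lemma Sm.sliceX {h : E × E → F} (hh : Sm h) (y : E) : Sm (fun x => h (x, y)) :=
  ContDiff.comp hh (contDiff_id.prodMk contDiff_const)

lemma Sm.sliceY {h : E × E → F} (hh : Sm h) (x : E) : Sm (fun y => h (x, y)) :=
  ContDiff.comp hh (contDiff_const.prodMk contDiff_id)

lemma PB.sliceX {h : E × E → F} (hh : Sm h) {k : ℕ} {M : ℝ} (hb : PB dX k M h) (y : E) :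
    PB eb k M (fun x => h (x, y)) := by
  induction k generalizing h with
  | zero => exact fun x => hb (x, y)
  | succ k ih =>
    refine ⟨fun x => hb.1 (x, y), fun i => ?_⟩
    rw [dLine_sliceX hh]
    exact ih (Sm.dLine hh _) (hb.2 i)

lemma mvt_Y {q : E × E → F} (hq : Sm q) {M : ℝ} (hM : 0 ≤ M)
    (hb : ∀ j z, ‖dLine (dY j) q z‖ ≤ M) (x y y' : E) :
    ‖q (x, y') - q (x, y)‖ ≤ n * M * ‖y' - y‖ := by
  refine Convex.norm_image_sub_le_of_norm_fderiv_le (𝕜 := ℝ) (f := fun y => q (x, y)) (s := Set.univ)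
    (fun z _ => (hq.sliceY x).diff z) (fun z _ => ?_) convex_univ (Set.mem_univ _) (Set.mem_univ _)
  refine ContinuousLinearMap.opNorm_le_bound _ (by positivity) fun v => ?_
  conv_lhs => rw [vec_sum v]
  rw [map_sum]
  refine (norm_sum_le _ _).trans ?_
  have : ∀ i ∈ Finset.univ, ‖fderiv ℝ (fun y => q (x, y)) z (v i • eb i)‖ ≤ M * ‖v‖ := by
    intro i _
    rw [map_smul, norm_smul, fderiv_sliceY hq, mul_comm]
    exact mul_le_mul (hb i _) (coord_le v i) (by positivity) hM
  refine (Finset.sum_le_sum this).trans ?_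
  simp [mul_assoc]

lemma PB_diff {q : E × E → ℝ} (hq : Sm q) {M : ℝ} (hM : 0 ≤ M) (k : ℕ)
    (hb : ∀ j, PB dX k M (dLine (dY j) q)) (y y' : E) (hy : y' ≠ y) :
    PB eb k (n * M) (fun x => (((q (x, y') - q (x, y)) / ‖y' - y‖ : ℝ) : ℂ)) := by
  have hpos : 0 < ‖y' - y‖ := norm_pos_iff.2 (sub_ne_zero.2 hy)
  have h0 : ∀ (q : E × E → ℝ), Sm q → (∀ j z, ‖dLine (dY j) q z‖ ≤ M) → ∀ x,
      ‖(((q (x, y') - q (x, y)) / ‖y' - y‖ : ℝ) : ℂ)‖ ≤ n * M := by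
    intro q hq h x
    rw [Complex.norm_real, norm_div, norm_norm, div_le_iff₀ hpos]
    exact mvt_Y hq hM h x y y'
  induction k generalizing q with
  | zero => exact h0 q hq (fun j z => hb j z)
  | succ k ih =>
    refine ⟨h0 q hq (fun j z => (hb j).1 z), fun i => ?_⟩
    have := ih (q := dLine (dX i) q) (Sm.dLine hq _) (fun j => by
      rw [dLine_comm hq]; exact (hb j).2 i)
    convert this using 1
    ext x
    have hd : HasFDerivAt (fun x => (((q (x, y') - q (x, y)) / ‖y' - y‖ : ℝ) : ℂ))
        (Complex.ofRealCLM.comp ((‖y' - y‖)⁻¹ • (fderiv ℝ (fun x => q (x, y')) x - fderiv ℝ (fun x => q (x, y)) x))) x := by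
      refine Complex.ofRealCLM.hasFDerivAt.comp x ?_
      have := (((hq.sliceX y').diff x).hasFDerivAt.sub ((hq.sliceX y).diff x).hasFDerivAt).const_mul (‖y' - y‖)⁻¹
      have he : (fun x => (q (x, y') - q (x, y)) / ‖y' - y‖) =
          fun z => ‖y' - y‖⁻¹ * ((fun x => q (x, y')) - fun x => q (x, y)) z := by
        funext z
        exact div_eq_inv_mul _ _
      exact he ▸ this
    simp only [dLine, hd.fderiv]
    simp only [ContinuousLinearMap.comp_apply, ContinuousLinearMap.smul_apply,
      ContinuousLinearMap.sub_apply, fderiv_sliceX hq]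
    simp [dX, eb, div_eq_inv_mul]

end slices

/-- Bound for the inverse matrix. -/
lemma matrix_lower (H : Matrix (Fin n) (Fin n) ℝ) {C₀ M : ℝ} (hM : 0 ≤ M)
    (hdet : C₀ ≤ |H.det|) (hH : ∀ i j, |H i j| ≤ M) (v w : E)
    (hw : ∀ i, w i = ∑ j, H i j * v j) :
    C₀ * ‖v‖ ≤ n * (n * (n.factorial * (M + 1) ^ n)) * ‖w‖ := by
  have hadj : ∀ i j, |H.adjugate i j| ≤ n.factorial * (M + 1) ^ n := by
    intro i j
    rw [Matrix.adjugate_apply]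
    have := Matrix.det_le (A := H.updateRow j (Pi.single i 1)) (abv := AbsoluteValue.abs) (x := M + 1) (by
      intro a b
      rw [Matrix.updateRow_apply]
      simp only [AbsoluteValue.abs_apply]
      split_ifs
      · rw [Pi.single_apply]; split_ifs <;> simp <;> linarith
      · exact (hH a b).trans (by linarith))
    simpa using this
  have hv : ∀ i, H.det * v i = ∑ j, H.adjugate i j * w j := by
    intro i
    have h1 : (H.adjugate * H).mulVec (v : Fin n → ℝ) = H.adjugate.mulVec (w : Fin n → ℝ) := by
      rw [← Matrix.mulVec_mulVec]
      congr 1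
      ext i
      rw [hw]; rfl
    rw [Matrix.adjugate_mul] at h1
    have := congrFun h1 i
    simpa [Matrix.smul_mulVec, Matrix.mulVec, dotProduct, Matrix.one_apply] using this
  have hvi : ∀ i, |H.det| * |v i| ≤ n * (n.factorial * (M + 1) ^ n) * ‖w‖ := by
    intro i
    rw [← abs_mul, hv]
    refine (Finset.abs_sum_le_sum_abs _ _).trans ?_
    have : ∀ j ∈ Finset.univ, |H.adjugate i j * w j| ≤ (n.factorial * (M + 1) ^ n) * ‖w‖ := by
      intro j _
      rw [abs_mul]
      exact mul_le_mul (hadj i j) (coord_le w j) (abs_nonneg _) (by positivity)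
    refine (Finset.sum_le_sum this).trans ?_
    simp [mul_assoc]
  calc C₀ * ‖v‖ ≤ |H.det| * ‖v‖ := by gcongr
    _ ≤ |H.det| * ∑ i, |v i| := by gcongr; exact norm_le_sum v
    _ = ∑ i, |H.det| * |v i| := Finset.mul_sum _ _ _
    _ ≤ ∑ i : Fin n, n * (n.factorial * (M + 1) ^ n) * ‖w‖ := Finset.sum_le_sum fun i _ => hvi i
    _ = _ := by simp [mul_assoc]

/-- The standing assumptions. -/
structure Good (n : ℕ) (C₀ M : ℝ) (a : EuclideanSpace ℝ (Fin n) × EuclideanSpace ℝ (Fin n) → ℂ)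
    (φ : EuclideanSpace ℝ (Fin n) × EuclideanSpace ℝ (Fin n) → ℝ) : Prop where
  sa : Sm a
  sφ : Sm φ
  det : ∀ z, C₀ ≤ |Matrix.det (Matrix.of fun i j => mixedHessXY φ i j z)|
  hx : ∀ i j, PB dX (2 * n + 1) M (mixedHessXY φ i j)
  hy : ∀ i j, PB dY (2 * n + 1) M (mixedHessXY φ i j)
  ax : PB dX (2 * n + 1) 1 a
  ay : PB dY (2 * n + 1) 1 a

section swap
variable {F : Type*} [NormedAddCommGroup F] [NormedSpace ℝ F]

lemma fderiv_swap {g : E × E → F} (hg : Sm g) (z v : E × E) :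
    fderiv ℝ (fun z : E × E => g z.swap) z v = fderiv ℝ g z.swap v.swap := by
  have h1 : HasFDerivAt (fun z : E × E => z.swap)
      ((ContinuousLinearMap.snd ℝ E E).prod (ContinuousLinearMap.fst ℝ E E)) z :=
    ((ContinuousLinearMap.snd ℝ E E).prod (ContinuousLinearMap.fst ℝ E E)).hasFDerivAt
  have := ((hg.diff z.swap).hasFDerivAt.comp z h1).fderiv
  have h2 : (g ∘ fun z : E × E => z.swap) = fun z => g z.swap := rfl
  rw [h2] at this
  rw [this]
  rfl

lemma Sm.swap {g : E × E → F} (hg : Sm g) : Sm (fun z : E × E => g z.swap) :=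
  ContDiff.comp hg (contDiff_snd.prodMk contDiff_fst)

lemma dX_swap {g : E × E → F} (hg : Sm g) (i : Fin n) :
    dLine (dX i) (fun z : E × E => g z.swap) = fun z : E × E => dLine (dY i) g z.swap := by
  ext z
  exact fderiv_swap hg z _

lemma dY_swap {g : E × E → F} (hg : Sm g) (i : Fin n) :
    dLine (dY i) (fun z : E × E => g z.swap) = fun z : E × E => dLine (dX i) g z.swap := by
  ext z
  exact fderiv_swap hg z _

lemma PB.swapX {g : E × E → F} (hg : Sm g) {k : ℕ} {M : ℝ} (h : PB dY k M g) :
    PB dX k M (fun z : E × E => g z.swap) := by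
  induction k generalizing g with
  | zero => exact fun z => h _
  | succ k ih =>
    refine ⟨fun z => h.1 _, fun i => ?_⟩
    rw [dX_swap hg]
    exact ih (Sm.dLine hg _) (h.2 i)

lemma PB.swapY {g : E × E → F} (hg : Sm g) {k : ℕ} {M : ℝ} (h : PB dX k M g) :
    PB dY k M (fun z : E × E => g z.swap) := by
  induction k generalizing g with
  | zero => exact fun z => h _
  | succ k ih =>
    refine ⟨fun z => h.1 _, fun i => ?_⟩
    rw [dY_swap hg]
    exact ih (Sm.dLine hg _) (h.2 i)

lemma mixedHess_swap {φ : E × E → ℝ} (hφ : Sm φ) (i j : Fin n) :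
    mixedHessXY (fun z : E × E => φ z.swap) i j = fun z : E × E => mixedHessXY φ j i z.swap := by
  unfold mixedHessXY
  rw [dY_swap hφ, dX_swap (Sm.dLine hφ _), dLine_comm hφ]

lemma Good.swap {C₀ M : ℝ} {a : E × E → ℂ} {φ : E × E → ℝ} (h : Good n C₀ M a φ) :
    Good n C₀ M (fun z => a z.swap) (fun z => φ z.swap) where
  sa := h.sa.swap
  sφ := h.sφ.swap
  det z := by
    have := h.det z.swap
    rw [← Matrix.det_transpose] at this
    convert this using 4
    ext i j
    simp [mixedHess_swap h.sφ]
  hx i j := by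
    rw [mixedHess_swap h.sφ]
    exact PB.swapX (Sm.dLine (Sm.dLine h.sφ _) _) (h.hy _ _)
  hy i j := by
    rw [mixedHess_swap h.sφ]
    exact PB.swapY (Sm.dLine (Sm.dLine h.sφ _) _) (h.hx _ _)
  ax := PB.swapX h.sa h.ay
  ay := PB.swapY h.sa h.ax

end swap

end phase

end OscInt


namespace OscInt

section lower
variable {n : ℕ}

local notation "E" => EuclideanSpace ℝ (Fin n)

lemma Good.M_nonneg {C₀ M : ℝ} {a : E × E → ℂ} {φ : E × E → ℝ} (h : Good n C₀ M a φ) (hn : 0 < n) :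
    0 ≤ M := (h.hx ⟨0, hn⟩ ⟨0, hn⟩).nonneg

lemma dY_dX {φ : E × E → ℝ} (hφ : Sm φ) (i j : Fin n) :
    dLine (dY j) (dLine (dX i) φ) = mixedHessXY φ i j := by
  unfold mixedHessXY
  rw [dLine_comm hφ]

/-- The gradient map. -/
def gradMap (φ : E × E → ℝ) (x y : E) : E := WithLp.toLp 2 (fun i => dLine (dX i) φ (x, y))

/-- Its derivative. -/
def gradMap' (φ : E × E → ℝ) (x y : E) : E →L[ℝ] E :=
  ((EuclideanSpace.equiv (Fin n) ℝ).symm : (Fin n → ℝ) →L[ℝ] E).comp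
    (ContinuousLinearMap.pi fun i => fderiv ℝ (fun y => dLine (dX i) φ (x, y)) y)

lemma gradMap'_apply {φ : E × E → ℝ} (hφ : Sm φ) (x y v : E) (i : Fin n) :
    gradMap' φ x y v i = ∑ j, mixedHessXY φ i j (x, y) * v j := by
  have : gradMap' φ x y v i = fderiv ℝ (fun y => dLine (dX i) φ (x, y)) y v := rfl
  rw [this]
  conv_lhs => rw [vec_sum v]
  rw [map_sum]
  refine Finset.sum_congr rfl fun j _ => ?_
  rw [map_smul, fderiv_sliceY (Sm.dLine hφ _), ← dY_dX hφ, smul_eq_mul, mul_comm]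
  rfl

lemma gradMap_deriv {φ : E × E → ℝ} (hφ : Sm φ) (x y : E) :
    HasFDerivAt (gradMap φ x) (gradMap' φ x y) y := by
  refine ((EuclideanSpace.equiv (Fin n) ℝ).symm : (Fin n → ℝ) →L[ℝ] E).hasFDerivAt.comp y ?_
  exact hasFDerivAt_pi.2 fun i => (((Sm.dLine hφ (dX i)).sliceY x).diff y).hasFDerivAt

lemma grad_lower (n : ℕ) (C₀ M : ℝ) (hC₀ : 0 < C₀) : ∃ c > 0, ∀ a φ, Good n C₀ M a φ → ∀ x y y',
    c * ‖y' - y‖ ≤ ‖gradMap φ x y' - gradMap φ x y‖ := by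
  rcases Nat.eq_zero_or_pos n with rfl | hn
  · refine ⟨1, one_pos, fun a φ _ x y y' => ?_⟩
    rw [Subsingleton.elim y' y]; simp
  by_cases hM : 0 ≤ M
  swap
  · exact ⟨1, one_pos, fun a φ h => absurd (h.M_nonneg hn) hM⟩
  set B : ℝ := n * (n * (n.factorial * (M + 1) ^ n)) + 1 with hB
  have hBpos : 0 < B := by positivity
  refine ⟨C₀ / B / 2, by positivity, fun a φ h x y y' => ?_⟩
  refine Hadamard.lower_bound (gradMap φ x) (gradMap' φ x) (fun y => gradMap_deriv h.sφ x y)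
    (C₀ / B) (n * (n * (n * M)) + 1) (by positivity) (by positivity) ?_ ?_ y' y
  · intro y v
    have := matrix_lower (Matrix.of fun i j => mixedHessXY φ i j (x, y)) hM (h.det (x, y))
      (fun i j => (h.hx i j).bound (x, y)) v (gradMap' φ x y v) (fun i => gradMap'_apply h.sφ x y v i)
    rw [div_mul_eq_mul_div, div_le_iff₀ hBpos]
    refine this.trans ?_
    rw [mul_comm _ B]
    gcongr
    linarith
  · intro y w
    refine ContinuousLinearMap.opNorm_le_bound _ (by positivity) fun v => ?_
    refine (norm_le_sum _).trans ?_
    have hij : ∀ i j : Fin n, |mixedHessXY φ i j (x, y) - mixedHessXY φ i j (x, w)| ≤ n * M * ‖y - w‖ := by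
      intro i j
      refine mvt_Y (Sm.dLine (Sm.dLine h.sφ _) _) hM (fun k z => ?_) x w y
      exact ((h.hy i j).2 k).bound z
    have hi : ∀ i : Fin n, |((gradMap' φ x y - gradMap' φ x w) v) i| ≤ n * (n * M * ‖y - w‖ * ‖v‖) := by
      intro i
      have : ((gradMap' φ x y - gradMap' φ x w) v) i
          = ∑ j, (mixedHessXY φ i j (x, y) - mixedHessXY φ i j (x, w)) * v j := by
        simp only [sub_mul, Finset.sum_sub_distrib, ← gradMap'_apply h.sφ]
        rfl
      rw [this]
      refine (Finset.abs_sum_le_sum_abs _ _).trans ?_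
      have : ∀ j ∈ Finset.univ, |(mixedHessXY φ i j (x, y) - mixedHessXY φ i j (x, w)) * v j|
          ≤ n * M * ‖y - w‖ * ‖v‖ := by
        intro j _
        rw [abs_mul]
        exact mul_le_mul (hij i j) (coord_le v j) (abs_nonneg _) (by positivity)
      refine (Finset.sum_le_sum this).trans ?_
      simp
    refine (Finset.sum_le_sum fun i _ => hi i).trans ?_
    simp only [Finset.sum_const, Finset.card_univ, Fintype.card_fin, nsmul_eq_mul]
    have : 0 ≤ ‖y - w‖ * ‖v‖ := by positivity
    nlinarith

end lower

/-! ### bumps -/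
section bump
variable {n : ℕ}

local notation "E" => EuclideanSpace ℝ (Fin n)

/-- One dimensional bump. -/
def g1 (t : ℝ) : ℝ := Real.smoothTransition (t + 1) - Real.smoothTransition t

lemma g1_smooth : Sm g1 := by
  have h : Sm Real.smoothTransition := Real.smoothTransition.contDiff
  exact (h.comp (contDiff_id.add contDiff_const)).sub h

lemma g1_abs (t : ℝ) : |g1 t| ≤ 1 := by
  have h1 := Real.smoothTransition.nonneg t
  have h2 := Real.smoothTransition.le_one t
  have h3 := Real.smoothTransition.nonneg (t+1)
  have h4 := Real.smoothTransition.le_one (t+1)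
  unfold g1
  rw [abs_le]; constructor <;> linarith

lemma g1_zero (t : ℝ) (h : 1 < |t|) : g1 t = 0 := by
  unfold g1
  rcases lt_abs.1 h with h | h
  · rw [Real.smoothTransition.one_of_one_le (by linarith), Real.smoothTransition.one_of_one_le h.le, sub_self]
  · rw [Real.smoothTransition.zero_of_nonpos (by linarith), Real.smoothTransition.zero_of_nonpos (by linarith), sub_self]

/-- The lattice point. -/
def kv (k : Fin n → ℤ) : E := WithLp.toLp 2 (fun i => (k i : ℝ))

/-- The bump at zero. -/
def bump0 (x : E) : ℝ := ∏ i, g1 (x i)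

/-- The bump at a lattice point. -/
def bump (k : Fin n → ℤ) (x : E) : ℝ := bump0 (x - kv k)

lemma bump0_smooth : Sm (bump0 (n := n)) := by
  unfold bump0
  refine contDiff_prod fun i _ => g1_smooth.comp ?_
  exact contDiff_piLp_apply (p := 2)

lemma bump_smooth (k : Fin n → ℤ) : Sm (bump k) :=
  bump0_smooth.comp (contDiff_id.sub contDiff_const)

lemma bump_abs (k : Fin n → ℤ) (x : E) : |bump k x| ≤ 1 := by
  unfold bump bump0
  rw [Finset.abs_prod]
  exact Finset.prod_le_one (fun i _ => abs_nonneg _) (fun i _ => g1_abs _)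

lemma bump0_zero (x : E) (h : x ∉ Metric.closedBall (0 : E) n) : bump0 x = 0 := by
  by_contra hne
  apply h
  rw [mem_closedBall_zero_iff]
  refine (norm_le_sum x).trans ?_
  have : ∀ i ∈ Finset.univ, |x i| ≤ 1 := by
    intro i _
    by_contra hi
    exact hne (Finset.prod_eq_zero (Finset.mem_univ i) (g1_zero _ (not_le.1 hi)))
  refine (Finset.sum_le_sum this).trans ?_
  simp

lemma bump_zero (k : Fin n → ℤ) (x : E) (h : x ∉ Metric.closedBall (kv k) n) : bump k x = 0 := by
  apply bump0_zero
  simpa [dist_eq_norm] using h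

lemma dLine_translate {F : Type*} [NormedAddCommGroup F] [NormedSpace ℝ F] (f : E → F) (c v : E) :
    dLine v (fun x => f (x - c)) = fun x => dLine v f (x - c) := by
  ext x
  simp only [dLine]
  simp only [sub_eq_add_neg]; rw [fderiv_comp_add_right (-c)]

lemma PB.translate {F : Type*} [NormedAddCommGroup F] [NormedSpace ℝ F] {f : E → F} {m : ℕ} {M : ℝ}
    (h : PB eb m M f) (c : E) : PB eb m M (fun x => f (x - c)) := by
  induction m generalizing f with
  | zero => exact fun x => h _
  | succ k ih =>
    refine ⟨fun x => h.1 _, fun i => ?_⟩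
    rw [dLine_translate]
    exact ih (h.2 i)

lemma PB_of_compact {f : E → ℂ} (hf : Sm f) {S : Set E} (hS : IsCompact S)
    (h0 : ∀ x, x ∉ S → f x = 0) (m : ℕ) : ∃ M, PB eb m M f := by
  have hb : ∀ f : E → ℂ, Sm f → (∀ x, x ∉ S → f x = 0) → ∃ M, ∀ x, ‖f x‖ ≤ M := by
    intro f hf h0
    obtain ⟨M, hM⟩ := hS.exists_bound_of_continuousOn (f := f) hf.continuous.continuousOn
    refine ⟨max M 0, fun x => ?_⟩
    by_cases hx : x ∈ S
    · exact (hM x hx).trans (le_max_left _ _)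
    · rw [h0 x hx, norm_zero]; exact le_max_right _ _
  induction m generalizing f with
  | zero => exact hb f hf h0
  | succ m ih =>
    have := UB.of_succ (e := eb) (ι := Unit) (f := fun _ => f) (k := m) (fun _ => hf)
      (by obtain ⟨M, hM⟩ := hb f hf h0; exact ⟨M, fun _ => hM⟩) (fun j => by
        obtain ⟨M, hM⟩ := ih (Sm.dLine hf (eb j)) (fun x hx => dLine_zero_off hS.isClosed h0 _ x hx)
        exact ⟨fun _ => Sm.dLine hf _, M, fun _ => hM⟩)
    obtain ⟨M, hM⟩ := this.2
    exact ⟨M, hM ()⟩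

lemma ofReal_smooth {f : E → ℝ} (hf : Sm f) : Sm (fun x => (f x : ℂ)) :=
  Complex.ofRealCLM.contDiff.comp hf

lemma bump_PB (n m : ℕ) : ∃ M, ∀ k : Fin n → ℤ, PB eb m M (fun x => (bump k x : ℂ)) := by
  obtain ⟨M, hM⟩ := PB_of_compact (n := n) (ofReal_smooth bump0_smooth)
    (isCompact_closedBall (0 : EuclideanSpace ℝ (Fin n)) n) (fun x hx => by simp [bump0_zero x hx]) m
  exact ⟨M, fun k => hM.translate (kv k)⟩

lemma sum_g1 (t : ℝ) (R : ℕ) : ∑ k ∈ Finset.Icc (-(R : ℤ)) R, g1 (t - k) =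
    Real.smoothTransition (t + R + 1) - Real.smoothTransition (t - R) := by
  induction R with
  | zero => simp [g1]
  | succ R ih =>
    have : Finset.Icc (-((R + 1 : ℕ) : ℤ)) ((R + 1 : ℕ) : ℤ) =
        insert (-((R + 1 : ℕ) : ℤ)) (insert ((R + 1 : ℕ) : ℤ) (Finset.Icc (-(R : ℤ)) R)) := by
      ext x
      simp only [Finset.mem_Icc, Finset.mem_insert]
      push_cast
      omega
    rw [this, Finset.sum_insert, Finset.sum_insert, ih]
    · simp only [g1]
      push_cast
      ring_nf
    · simp
    · simp only [Finset.mem_insert, Finset.mem_Icc]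
      push_cast
      omega

/-- The finite index box. -/
def box (n R : ℕ) : Finset (Fin n → ℤ) := Fintype.piFinset fun _ => Finset.Icc (-(R : ℤ)) R

lemma sum_bump (x : E) (R : ℕ) : ∑ k ∈ box n R, bump k x =
    ∏ i, (Real.smoothTransition (x i + R + 1) - Real.smoothTransition (x i - R)) := by
  simp only [← sum_g1]
  rw [Finset.prod_univ_sum]
  rfl

lemma sum_bump_abs (x : E) (R : ℕ) : |∑ k ∈ box n R, bump k x| ≤ 1 := by
  rw [sum_bump, Finset.abs_prod]
  refine Finset.prod_le_one (fun i _ => abs_nonneg _) (fun i _ => ?_)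
  have h1 := Real.smoothTransition.nonneg (x i + R + 1)
  have h2 := Real.smoothTransition.le_one (x i + R + 1)
  have h3 := Real.smoothTransition.nonneg (x i - R)
  have h4 := Real.smoothTransition.le_one (x i - R)
  rw [abs_le]; constructor <;> linarith

lemma sum_bump_one (x : E) (R : ℕ) (h : ‖x‖ ≤ R) : ∑ k ∈ box n R, bump k x = 1 := by
  rw [sum_bump]
  refine Finset.prod_eq_one fun i _ => ?_
  have := abs_le.1 ((coord_le x i).trans h)
  rw [Real.smoothTransition.one_of_one_le (by linarith), Real.smoothTransition.zero_of_nonpos (by linarith), sub_zero]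

end bump

end OscInt


namespace OscInt

section key
variable {n : ℕ}

local notation "E" => EuclideanSpace ℝ (Fin n)

/-- The localized kernel. -/
def Ker (a : E × E → ℂ) (φ : E × E → ℝ) (k l : Fin n → ℤ) (x y : E) : ℂ :=
  cexp (I * φ (x, y)) * a (x, y) * ((bump k x : ℂ) * (bump l y : ℂ))

/-- Parameter space for the uniform estimate. -/
structure Par (n : ℕ) (C₀ M : ℝ) where
  a : EuclideanSpace ℝ (Fin n) × EuclideanSpace ℝ (Fin n) → ℂ
  φ : EuclideanSpace ℝ (Fin n) × EuclideanSpace ℝ (Fin n) → ℝ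
  good : Good n C₀ M a φ
  k : Fin n → ℤ
  k' : Fin n → ℤ
  y : EuclideanSpace ℝ (Fin n)
  y' : EuclideanSpace ℝ (Fin n)
  ne : y' ≠ y

lemma key_decay0 (n : ℕ) (C₀ M : ℝ) (hC₀ : 0 < C₀) : ∃ C, ∀ p : Par n C₀ M,
    ‖∫ x, cexp (I * ((p.φ (x, p.y') - p.φ (x, p.y) : ℝ) : ℂ)) *
      ((p.a (x, p.y') * (starRingEnd ℂ) (p.a (x, p.y))) * ((bump p.k x : ℂ) * (bump p.k' x : ℂ)))‖
      * ‖p.y' - p.y‖ ^ (2 * n + 1) ≤ C := by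
  obtain ⟨c, hc, hlow⟩ := grad_lower n C₀ M hC₀
  obtain ⟨Mb, hMb⟩ := bump_PB n (2 * n + 1)
  have hder : ∀ (p : Par n C₀ M) (j : Fin n) x, 
      dLine (eb j) (fun x => p.φ (x, p.y') - p.φ (x, p.y)) x
        = dLine (dX j) p.φ (x, p.y') - dLine (dX j) p.φ (x, p.y) := by
    intro p j x
    have h1 := (p.good.sφ.sliceX p.y')
    have h2 := (p.good.sφ.sliceX p.y)
    rw [← congrFun (dLine_sliceX p.good.sφ j p.y') x, ← congrFun (dLine_sliceX p.good.sφ j p.y) x]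
    simp only [dLine]
    rw [fderiv_fun_sub (h1.diff x) (h2.diff x)]; rfl
  refine osc_decay (ι := Par n C₀ M) (fun p x => p.φ (x, p.y') - p.φ (x, p.y))
    (fun p x => (p.a (x, p.y') * (starRingEnd ℂ) (p.a (x, p.y))) * ((bump p.k x : ℂ) * (bump p.k' x : ℂ)))
    (fun p => ‖p.y' - p.y‖) (fun p => Metric.closedBall (kv p.k) n) (2 * n + 1) (c ^ 2)
    (volume.real (Metric.closedBall (0 : EuclideanSpace ℝ (Fin n)) n)) (by positivity)
    (fun p => (p.good.sφ.sliceX p.y').sub (p.good.sφ.sliceX p.y))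
    (fun p => norm_pos_iff.2 (sub_ne_zero.2 p.ne)) ?_ ?_ ?_ (fun p => isCompact_closedBall _ _) ?_ ?_
  · intro j
    simp only [hder]
    refine ⟨fun p => ?_, n * max M 0, fun p => ?_⟩
    · exact ofReal_smooth ((((Sm.dLine p.good.sφ (dX j)).sliceX p.y').sub
        ((Sm.dLine p.good.sφ (dX j)).sliceX p.y)).div_const _)
    · refine PB_diff (Sm.dLine p.good.sφ (dX j)) (le_max_right _ _) _ (fun i => ?_) p.y p.y' p.ne
      rw [dY_dX p.good.sφ]
      exact (p.good.hx j i).mono (le_max_left _ _)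
  · intro p x
    simp only [hder]
    have h := hlow _ _ p.good x p.y p.y'
    have hp : 0 < ‖p.y' - p.y‖ := norm_pos_iff.2 (sub_ne_zero.2 p.ne)
    have h2 : ‖gradMap p.φ x p.y' - gradMap p.φ x p.y‖ ^ 2 =
        ∑ j, (dLine (dX j) p.φ (x, p.y') - dLine (dX j) p.φ (x, p.y)) ^ 2 := by
      rw [EuclideanSpace.norm_sq_eq]
      refine Finset.sum_congr rfl fun i _ => ?_
      rw [Real.norm_eq_abs, sq_abs]; rfl
    simp only [div_pow]
    rw [← Finset.sum_div, ← h2, le_div_iff₀ (by positivity), ← mul_pow]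
    gcongr
  · have hA : UB eb (2 * n + 1) (fun (p : Par n C₀ M) x => p.a (x, p.y')) :=
      ⟨fun p => p.good.sa.sliceX _, 1, fun p => p.good.ax.sliceX p.good.sa _⟩
    have hA' : UB eb (2 * n + 1) (fun (p : Par n C₀ M) x => p.a (x, p.y)) :=
      ⟨fun p => p.good.sa.sliceX _, 1, fun p => p.good.ax.sliceX p.good.sa _⟩
    have hA'' : UB eb (2 * n + 1) (fun (p : Par n C₀ M) x => (starRingEnd ℂ) (p.a (x, p.y))) :=
      hA'.clm (Complex.conjCLE : ℂ →L[ℝ] ℂ) (fun z => by simp)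
    have hb : UB eb (2 * n + 1) (fun (p : Par n C₀ M) x => (bump p.k x : ℂ)) :=
      ⟨fun p => ofReal_smooth (bump_smooth _), Mb, fun p => hMb _⟩
    have hb' : UB eb (2 * n + 1) (fun (p : Par n C₀ M) x => (bump p.k' x : ℂ)) :=
      ⟨fun p => ofReal_smooth (bump_smooth _), Mb, fun p => hMb _⟩
    exact (hA.mul hA'').mul (hb.mul hb')
  · intro p
    rw [measureReal_def, measureReal_def]
    refine le_of_eq ?_
    congr 1
    exact Measure.addHaar_closedBall_center _ _ _
  · intro p x hx
    simp [bump_zero p.k x hx]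

lemma Ker_norm {C₀ M : ℝ} {a : E × E → ℂ} {φ : E × E → ℝ} (h : Good n C₀ M a φ) (k l : Fin n → ℤ)
    (x y : E) : ‖Ker a φ k l x y‖ ≤ 1 := by
  unfold Ker
  rw [norm_mul, norm_mul, norm_mul, mul_comm I, Complex.norm_exp_ofReal_mul_I, one_mul,
    Complex.norm_real, Complex.norm_real]
  have h1 := h.ax.bound (x, y)
  have h2 := bump_abs k x
  have h3 := bump_abs l y
  have := mul_le_one₀ h2 (abs_nonneg _) h3
  exact mul_le_one₀ h1 (by positivity) this

lemma Ker_zero (a : E × E → ℂ) (φ : E × E → ℝ) (k l : Fin n → ℤ) (x y : E)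
    (h : ¬ (x ∈ Metric.closedBall (kv k) n ∧ y ∈ Metric.closedBall (kv l) n)) :
    Ker a φ k l x y = 0 := by
  unfold Ker
  rw [not_and_or] at h
  rcases h with h | h
  · simp [bump_zero k x h]
  · simp [bump_zero l y h]

/-- The weight. -/
def wt (k k' : Fin n → ℤ) : ℝ := (1 + ‖kv k - kv k'‖)

lemma kv_close {k k' : Fin n → ℤ} {x : E} {x' : E} (hx : x ∈ Metric.closedBall (kv k) n)
    (hx' : x' ∈ Metric.closedBall (kv k') n) : ‖kv k - kv k'‖ ≤ ‖x - x'‖ + 2 * n := by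
  rw [Metric.mem_closedBall, dist_eq_norm] at hx hx'
  have : kv k - kv k' = (x - x') - (x - kv k) + (x' - kv k') := by abel
  rw [this]
  refine (norm_add_le _ _).trans ?_
  have := norm_sub_le (x - x') (x - kv k)
  linarith

lemma key_decay (n : ℕ) (C₀ M : ℝ) (hC₀ : 0 < C₀) : ∃ C, 0 ≤ C ∧ ∀ a φ, Good n C₀ M a φ →
    ∀ k l k' l' : Fin n → ℤ, ∀ y y',
    ‖∫ x, (starRingEnd ℂ) (Ker a φ k l x y) * Ker a φ k' l' x y'‖ * 
      (wt k k' * wt l l') ^ (2 * n + 1) ≤ C := by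
  obtain ⟨C, hC⟩ := key_decay0 n C₀ M hC₀
  set V := (volume.real (Metric.closedBall (0 : EuclideanSpace ℝ (Fin n)) n))
  have hV : 0 ≤ V := measureReal_nonneg
  set P : ℝ := 1 + 2 * n
  set N := 2 * n + 1
  have hP : 0 < P := by positivity
  refine ⟨(P ^ N) * (2 ^ N * (max C 0 + V * P ^ N) ), by positivity, ?_⟩
  intro a φ h k l k' l' y y'
  by_cases hsupp : y ∈ Metric.closedBall (kv l) n ∧ y' ∈ Metric.closedBall (kv l') n ∧
      ∃ x, x ∈ Metric.closedBall (kv k) n ∧ x ∈ Metric.closedBall (kv k') n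
  swap
  · have : ∀ x, (starRingEnd ℂ) (Ker a φ k l x y) * Ker a φ k' l' x y' = 0 := by
      intro x
      by_contra hne
      rw [mul_eq_zero, not_or] at hne
      have h1 : Ker a φ k l x y ≠ 0 := by simpa using hne.1
      have h1' := not_not.1 (mt (Ker_zero a φ k l x y) h1)
      have h2' := not_not.1 (mt (Ker_zero a φ k' l' x y') hne.2)
      exact hsupp ⟨h1'.2, h2'.2, x, h1'.1, h2'.1⟩
    simp only [this, integral_zero, norm_zero, zero_mul]
    positivity
  obtain ⟨hy, hy', x₀, hx, hx'⟩ := hsupp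
  have hk : wt k k' ≤ P := by
    have := kv_close hx hx'
    simp only [sub_self, norm_zero, zero_add] at this
    unfold wt; linarith
  have hl : wt l l' ≤ ‖y' - y‖ + P := by
    have := kv_close hy hy'
    rw [norm_sub_rev y y'] at this
    unfold wt; linarith
  have hk0 : 0 ≤ wt k k' := by unfold wt; positivity
  have hl0 : 0 ≤ wt l l' := by unfold wt; positivity
  set J := ‖∫ x, (starRingEnd ℂ) (Ker a φ k l x y) * Ker a φ k' l' x y'‖ with hJ
  have hJ0 : 0 ≤ J := norm_nonneg _
  have hJV : J ≤ V := by
    have h0 : ∀ x ∉ Metric.closedBall (kv k) (n : ℝ), (starRingEnd ℂ) (Ker a φ k l x y) * Ker a φ k' l' x y' = 0 := by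
      intro x hx
      rw [Ker_zero a φ k l x y (fun h => hx h.1)]; simp
    rw [hJ, ← setIntegral_eq_integral_of_forall_compl_eq_zero h0]
    have := norm_setIntegral_le_of_norm_le_const (μ := volume) (s := Metric.closedBall (kv k) (n : ℝ)) (C := 1)
      (f := fun x => (starRingEnd ℂ) (Ker a φ k l x y) * Ker a φ k' l' x y') measure_closedBall_lt_top
      (fun x _ => by
        rw [norm_mul, RCLike.norm_conj]
        exact mul_le_one₀ (Ker_norm h _ _ _ _) (norm_nonneg _) (Ker_norm h _ _ _ _))
    rw [one_mul] at this
    refine this.trans (le_of_eq ?_)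
    simp only [V, measureReal_def]
    congr 1
    exact Measure.addHaar_closedBall_center _ _ _
  have hJC : J * ‖y' - y‖ ^ N ≤ max C 0 := by
    by_cases hne : y' = y
    · subst hne
      simp [N]
    refine le_trans ?_ ((hC ⟨a, φ, h, k, k', y, y', hne⟩).trans (le_max_left _ _))
    refine mul_le_mul_of_nonneg_right ?_ (by positivity)
    have : (fun x => (starRingEnd ℂ) (Ker a φ k l x y) * Ker a φ k' l' x y') = fun x =>
      ((bump l y : ℂ) * (bump l' y' : ℂ)) * (cexp (I * ((φ (x, y') - φ (x, y) : ℝ) : ℂ)) *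
      ((a (x, y') * (starRingEnd ℂ) (a (x, y))) * ((bump k x : ℂ) * (bump k' x : ℂ)))) := by
      funext x
      have he : cexp (I * ((φ (x, y') - φ (x, y) : ℝ) : ℂ)) =
          cexp (I * φ (x, y')) * (starRingEnd ℂ) (cexp (I * φ (x, y))) := by
        rw [← Complex.exp_conj, ← Complex.exp_add]
        congr 1
        simp
        ring
      rw [he]
      simp only [Ker, map_mul, Complex.conj_ofReal]
      ring
    rw [hJ, this, integral_const_mul, norm_mul]
    have h1 : ‖((bump l y : ℂ) * (bump l' y' : ℂ))‖ ≤ 1 := by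
      rw [norm_mul, Complex.norm_real, Complex.norm_real]
      exact mul_le_one₀ (bump_abs _ _) (abs_nonneg _) (bump_abs _ _)
    exact mul_le_of_le_one_left (norm_nonneg _) h1
  calc J * (wt k k' * wt l l') ^ N = wt k k' ^ N * (J * wt l l' ^ N) := by ring
    _ ≤ P ^ N * (J * (‖y' - y‖ + P) ^ N) := by gcongr
    _ ≤ P ^ N * (J * (2 ^ N * (‖y' - y‖ ^ N + P ^ N))) := by
        gcongr
        have := add_pow_le (norm_nonneg (y' - y)) hP.le N
        refine this.trans ?_
        gcongr
        · norm_num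
        · omega
    _ = P ^ N * (2 ^ N * (J * ‖y' - y‖ ^ N + J * P ^ N)) := by ring
    _ ≤ _ := by gcongr

end key

end OscInt


namespace OscInt

section ops
variable {X : Type*} [MeasurableSpace X] {μ : Measure X} [SigmaFinite μ]

/-- Bounded kernels supported in a product of sets of finite measure. -/
structure KP (μ : Measure X) (K : X → X → ℂ) (S S' : Set X) (M : ℝ) : Prop where
  meas : StronglyMeasurable (Function.uncurry K)
  M0 : 0 ≤ M
  bd : ∀ x y, ‖K x y‖ ≤ M
  z : ∀ x y, ¬ (x ∈ S ∧ y ∈ S') → K x y = 0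
  mS : MeasurableSet S
  mS' : MeasurableSet S'
  fS : μ S < ⊤
  fS' : μ S' < ⊤

/-- The integral operator on functions. -/
def opFun (μ : Measure X) (K : X → X → ℂ) (f : X → ℂ) (x : X) : ℂ := ∫ y, K x y * f y ∂μ

variable {K K' : X → X → ℂ} {S S' S₂ S₂' : Set X} {M M' : ℝ}

lemma ind_int (hS : MeasurableSet S) (fS : μ S < ⊤) {f : X → ℂ} (hf : MemLp f 2 μ) :
    Integrable (S.indicator fun y => (‖f y‖ : ℝ)) μ := by
  rw [integrable_indicator_iff hS]
  have : IsFiniteMeasure (μ.restrict S) := ⟨by simpa using fS⟩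
  exact ((hf.restrict S).integrable (by norm_num)).norm

lemma KP.bd_ind (h : KP μ K S S' M) (x y : X) : ‖K x y‖ ≤ M * S'.indicator (fun _ => (1:ℝ)) y := by
  by_cases hy : y ∈ S'
  · simpa [hy] using h.bd x y
  · rw [h.z x y (fun h => hy h.2)]; simp [hy]

lemma KP.bd_f (h : KP μ K S S' M) (f : X → ℂ) (x y : X) :
    ‖K x y * f y‖ ≤ M * S'.indicator (fun y => ‖f y‖) y := by
  rw [norm_mul]
  by_cases hy : y ∈ S'
  · simp only [hy, Set.indicator_of_mem]
    exact mul_le_mul_of_nonneg_right (h.bd x y) (norm_nonneg _)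
  · rw [h.z x y (fun h => hy h.2)]; simp [hy]

lemma KP.integrable (h : KP μ K S S' M) {f : X → ℂ} (hf : MemLp f 2 μ) (x : X) :
    Integrable (fun y => K x y * f y) μ := by
  refine Integrable.mono' ((ind_int h.mS' h.fS' hf).const_mul M) ?_ (Filter.Eventually.of_forall (h.bd_f f x))
  exact ((h.meas.comp_measurable measurable_prodMk_left).aestronglyMeasurable).mul hf.1

lemma KP.ptwise (h : KP μ K S S' M) {f : X → ℂ} (hf : MemLp f 2 μ) (x : X) :
    ‖opFun μ K f x‖ₑ ≤ ENNReal.ofReal M * (eLpNorm f 2 μ * μ S' ^ (1/2 : ℝ)) := by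
  unfold opFun
  refine (enorm_integral_le_lintegral_enorm _).trans ?_
  have h1 : ∫⁻ y, ‖K x y * f y‖ₑ ∂μ ≤ ∫⁻ y, ENNReal.ofReal M * S'.indicator (fun y => ‖f y‖ₑ) y ∂μ := by
    refine lintegral_mono fun y => ?_
    by_cases hy : y ∈ S'
    · simp only [hy, Set.indicator_of_mem, enorm_mul]
      gcongr
      rw [← ofReal_norm_eq_enorm]
      exact ENNReal.ofReal_le_ofReal (h.bd x y)
    · rw [h.z x y (fun h => hy h.2)]; simp [hy]
  refine h1.trans ?_
  rw [lintegral_const_mul' _ _ ENNReal.ofReal_ne_top, lintegral_indicator h.mS']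
  gcongr
  rw [← eLpNorm_one_eq_lintegral_enorm]
  have := eLpNorm_le_eLpNorm_mul_rpow_measure_univ (p := 1) (q := 2) (μ := μ.restrict S') (by norm_num)
    (hf.1.mono_measure Measure.restrict_le_self)
  refine this.trans ?_
  rw [Measure.restrict_apply_univ]
  have h3 : (1 / (1 : ℝ≥0∞).toReal - 1 / (2 : ℝ≥0∞).toReal : ℝ) = 1 / 2 := by norm_num
  rw [h3]
  gcongr
  exact Measure.restrict_le_self

lemma opFun_meas (hK : StronglyMeasurable (Function.uncurry K)) {f : X → ℂ} (hf : AEStronglyMeasurable f μ) :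
    AEStronglyMeasurable (opFun μ K f) μ := by
  have : opFun μ K f = opFun μ K (hf.mk f) := by
    funext x
    refine integral_congr_ae ?_
    filter_upwards [hf.ae_eq_mk] with y hy
    rw [hy]
  rw [this]
  have h2 : StronglyMeasurable (fun p : X × X => K p.1 p.2 * hf.mk f p.2) :=
    hK.mul (hf.stronglyMeasurable_mk.comp_measurable measurable_snd)
  exact (StronglyMeasurable.integral_prod_right' h2).aestronglyMeasurable

lemma KP.opFun_zero (h : KP μ K S S' M) (f : X → ℂ) (x : X) (hx : x ∉ S) : opFun μ K f x = 0 := by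
  unfold opFun
  simp [h.z x _ (fun h => hx h.1)]

lemma KP.eLpNorm_le (h : KP μ K S S' M) {f : X → ℂ} (hf : MemLp f 2 μ) :
    eLpNorm (opFun μ K f) 2 μ ≤ ENNReal.ofReal (M * (√(μ.real S) * √(μ.real S'))) * eLpNorm f 2 μ := by
  have h1 : eLpNorm (opFun μ K f) 2 (μ.restrict S) = eLpNorm (opFun μ K f) 2 μ := by
    refine eLpNorm_restrict_eq_of_support_subset ?_
    intro x hx
    by_contra hn
    exact hx (h.opFun_zero f x hn)
  rw [← h1]
  have hfin : eLpNorm f 2 μ * μ S' ^ (1/2 : ℝ) ≠ ⊤ :=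
    ENNReal.mul_ne_top hf.2.ne (ENNReal.rpow_ne_top_of_nonneg (by norm_num) h.fS'.ne)
  set D := ENNReal.ofReal M * (eLpNorm f 2 μ * μ S' ^ (1/2 : ℝ)) with hD
  have hDt : D ≠ ⊤ := ENNReal.mul_ne_top ENNReal.ofReal_ne_top hfin
  have h2 := eLpNorm_le_of_ae_bound (p := 2) (μ := μ.restrict S) (f := opFun μ K f) (C := D.toReal) (by
    refine Filter.Eventually.of_forall fun x => ?_
    have := h.ptwise hf x
    rw [← toReal_enorm]
    exact ENNReal.toReal_mono hDt this)
  refine h2.trans (le_of_eq ?_)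
  rw [Measure.restrict_apply_univ, ENNReal.ofReal_toReal hDt, hD]
  have e1 : ∀ T : Set X, μ T < ⊤ → μ T ^ (1/2 : ℝ) = ENNReal.ofReal (√(μ.real T)) := by
    intro T hT
    rw [Real.sqrt_eq_rpow, ← ENNReal.ofReal_rpow_of_nonneg measureReal_nonneg (by norm_num), measureReal_def,
      ENNReal.ofReal_toReal hT.ne]
  have e2 : ((2 : ℝ≥0∞).toReal)⁻¹ = (1/2 : ℝ) := by norm_num
  rw [e2, e1 S h.fS, e1 S' h.fS', ENNReal.ofReal_mul h.M0, ENNReal.ofReal_mul (Real.sqrt_nonneg _)]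
  ring

lemma KP.memLp (h : KP μ K S S' M) {f : X → ℂ} (hf : MemLp f 2 μ) : MemLp (opFun μ K f) 2 μ :=
  ⟨opFun_meas h.meas hf.1, (h.eLpNorm_le hf).trans_lt (ENNReal.mul_lt_top ENNReal.ofReal_lt_top hf.2)⟩

/-- The integral operator on `L²`. -/
def KP.op (h : KP μ K S S' M) : Lp ℂ 2 μ →L[ℂ] Lp ℂ 2 μ :=
  LinearMap.mkContinuous
    { toFun := fun f => (h.memLp (Lp.memLp f)).toLp
      map_add' := by
        intro f g
        rw [← MemLp.toLp_add]
        refine MemLp.toLp_congr _ _ (Filter.Eventually.of_forall fun x => ?_)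
        simp only [Pi.add_apply, opFun]
        rw [← integral_add (h.integrable (Lp.memLp f) x) (h.integrable (Lp.memLp g) x)]
        refine integral_congr_ae ?_
        filter_upwards [Lp.coeFn_add f g] with y hy
        rw [hy, Pi.add_apply, mul_add]
      map_smul' := by
        intro c f
        rw [RingHom.id_apply, ← MemLp.toLp_const_smul]
        refine MemLp.toLp_congr _ _ (Filter.Eventually.of_forall fun x => ?_)
        simp only [Pi.smul_apply, opFun, smul_eq_mul]
        rw [← integral_const_mul]
        refine integral_congr_ae ?_
        filter_upwards [Lp.coeFn_smul c f] with y hy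
        rw [hy, Pi.smul_apply, smul_eq_mul]; ring }
    (M * (√(μ.real S) * √(μ.real S'))) (by
      intro f
      simp only [LinearMap.coe_mk, AddHom.coe_mk]
      rw [Lp.norm_toLp, Lp.norm_def]
      have := ENNReal.toReal_mono (ENNReal.mul_ne_top ENNReal.ofReal_ne_top (Lp.memLp f).2.ne) (h.eLpNorm_le (Lp.memLp f))
      rwa [ENNReal.toReal_mul, ENNReal.toReal_ofReal (mul_nonneg h.M0 (by positivity))] at this)

lemma KP.op_norm (h : KP μ K S S' M) : ‖h.op‖ ≤ M * (√(μ.real S) * √(μ.real S')) :=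
  LinearMap.mkContinuous_norm_le _ (mul_nonneg h.M0 (by positivity)) _

lemma KP.op_coe (h : KP μ K S S' M) (f : Lp ℂ 2 μ) : h.op f =ᵐ[μ] opFun μ K f :=
  MemLp.coeFn_toLp (h.memLp (Lp.memLp f))

/-- Adjoint kernel. -/
def adjK (K : X → X → ℂ) (x y : X) : ℂ := (starRingEnd ℂ) (K y x)

lemma KP.adj (h : KP μ K S S' M) : KP μ (adjK K) S' S M where
  meas := by
    have h1 : StronglyMeasurable (fun p : X × X => K p.2 p.1) :=
      h.meas.comp_measurable measurable_swap
    exact (Complex.continuous_conj).comp_stronglyMeasurable h1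
  M0 := h.M0
  bd x y := by simpa [adjK] using h.bd y x
  z x y hxy := by simp [adjK, h.z y x (fun h => hxy ⟨h.2, h.1⟩)]
  mS := h.mS'
  mS' := h.mS
  fS := h.fS'
  fS' := h.fS

lemma KP.star_op (h : KP μ K S S' M) : star h.op = h.adj.op := by
  rw [ContinuousLinearMap.star_eq_adjoint]
  symm
  rw [ContinuousLinearMap.eq_adjoint_iff]
  intro f g
  rw [L2.inner_def, L2.inner_def]
  have hF := Lp.memLp f
  have hG := Lp.memLp g
  have e1 : ∫ y, inner ℂ (h.adj.op f y) (g y) ∂μ = ∫ y, ∫ x, g y * (K x y * (starRingEnd ℂ) (f x)) ∂μ ∂μ := by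
    refine integral_congr_ae ?_
    filter_upwards [h.adj.op_coe f] with y hy
    rw [hy, RCLike.inner_apply, opFun, ← integral_conj, ← integral_const_mul]
    simp [adjK]
  have e2 : ∫ x, inner ℂ (f x) (h.op g x) ∂μ = ∫ x, ∫ y, g y * (K x y * (starRingEnd ℂ) (f x)) ∂μ ∂μ := by
    refine integral_congr_ae ?_
    filter_upwards [h.op_coe g] with x hx
    rw [hx, RCLike.inner_apply, opFun, ← integral_mul_const]
    congr 1
    funext y
    ring
  rw [e1, e2]
  refine integral_integral_swap ?_
  have hint := ((ind_int h.mS' h.fS' hG).const_mul M).mul_prod (ind_int h.mS h.fS hF)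
  refine hint.mono' ?_ (Filter.Eventually.of_forall ?_)
  · have h1 : AEStronglyMeasurable (fun p : X × X => g p.1) (μ.prod μ) := hG.1.comp_fst
    have h2 : AEStronglyMeasurable (fun p : X × X => f p.2) (μ.prod μ) := hF.1.comp_snd
    have h3 : StronglyMeasurable (fun p : X × X => K p.2 p.1) := h.meas.comp_measurable measurable_swap
    exact h1.mul (h3.aestronglyMeasurable.mul ((Complex.continuous_conj).comp_aestronglyMeasurable h2))
  · rintro ⟨y, x⟩
    simp only [Function.uncurry_apply_pair, norm_mul, RCLike.norm_conj]
    by_cases hxy : x ∈ S ∧ y ∈ S'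
    · simp only [hxy.1, hxy.2, Set.indicator_of_mem]
      have := h.bd x y
      calc ‖g y‖ * (‖K x y‖ * ‖f x‖) ≤ ‖g y‖ * (M * ‖f x‖) := by gcongr
        _ = _ := by ring
    · rw [h.z x y hxy]
      simp only [norm_zero, zero_mul, mul_zero]
      refine mul_nonneg (mul_nonneg h.M0 ?_) ?_ <;> exact Set.indicator_nonneg (fun _ _ => norm_nonneg _) _

/-- Composition kernel. -/
def compK (μ : Measure X) (K K' : X → X → ℂ) (x z : X) : ℂ := ∫ y, K x y * K' y z ∂μ

lemma KP.comp (h : KP μ K S S' M) (h' : KP μ K' S₂ S₂' M') {B : ℝ} (hB0 : 0 ≤ B)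
    (hB : ∀ x z, ‖compK μ K K' x z‖ ≤ B) : KP μ (compK μ K K') S S₂' B where
  meas := by
    have h1 : StronglyMeasurable (fun p : (X × X) × X => K p.1.1 p.2) :=
      h.meas.comp_measurable ((measurable_fst.comp measurable_fst).prodMk measurable_snd)
    have h2 : StronglyMeasurable (fun p : (X × X) × X => K' p.2 p.1.2) :=
      h'.meas.comp_measurable (measurable_snd.prodMk (measurable_snd.comp measurable_fst))
    exact StronglyMeasurable.integral_prod_right' (ν := μ) (h1.mul h2)
  M0 := hB0
  bd := hB
  z x z hxz := by
    unfold compK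
    have : ∀ y, K x y * K' y z = 0 := by
      intro y
      by_cases hx : x ∈ S
      · rw [h'.z y z (fun hh => hxz ⟨hx, hh.2⟩), mul_zero]
      · rw [h.z x y (fun hh => hx hh.1), zero_mul]
    simp [this]
  mS := h.mS
  mS' := h'.mS'
  fS := h.fS
  fS' := h'.fS'

lemma KP.op_mul (h : KP μ K S S' M) (h' : KP μ K' S₂ S₂' M') {B : ℝ} (hB0 : 0 ≤ B)
    (hB : ∀ x z, ‖compK μ K K' x z‖ ≤ B) : h.op * h'.op = (h.comp h' hB0 hB).op := by
  ext1 f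
  rw [ContinuousLinearMap.mul_apply]
  apply Lp.ext
  refine (h.op_coe _).trans (Filter.EventuallyEq.trans ?_ ((h.comp h' hB0 hB).op_coe f).symm)
  refine Filter.Eventually.of_forall fun x => ?_
  have hF := Lp.memLp f
  have e1 : opFun μ K (h'.op f) x = ∫ y, ∫ z, K x y * (K' y z * f z) ∂μ ∂μ := by
    unfold opFun
    refine integral_congr_ae ?_
    filter_upwards [h'.op_coe f] with y hy
    rw [hy, opFun, integral_const_mul]
  have e2 : opFun μ (compK μ K K') f x = ∫ z, ∫ y, K x y * (K' y z * f z) ∂μ ∂μ := by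
    unfold opFun compK
    congr 1
    funext z
    rw [← integral_mul_const]
    congr 1
    funext y
    ring
  simp only [e1, e2]
  refine integral_integral_swap ?_
  have hi : Integrable (S'.indicator fun _ => M) μ := by
    rw [integrable_indicator_iff h.mS']
    exact integrableOn_const h.fS'.ne
  have hint := hi.mul_prod ((ind_int h'.mS' h'.fS' hF).const_mul M')
  refine hint.mono' ?_ (Filter.Eventually.of_forall ?_)
  · have h1 : StronglyMeasurable (fun p : X × X => K x p.1) :=
      h.meas.comp_measurable (measurable_const.prodMk measurable_fst)
    exact h1.aestronglyMeasurable.mul (h'.meas.aestronglyMeasurable.mul hF.1.comp_snd)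
  · rintro ⟨y, z⟩
    simp only [Function.uncurry_apply_pair]
    rw [norm_mul]
    refine mul_le_mul ?_ (h'.bd_f f y z) (norm_nonneg _) (Set.indicator_nonneg (fun _ _ => h.M0) _)
    by_cases hy : y ∈ S'
    · simpa [hy] using h.bd x y
    · rw [h.z x y (fun hh => hy hh.2)]; simp [hy]

end ops

end OscInt


namespace OscInt

section weights

/-- One dimensional weight. -/
def gw (s : ℝ) (m : ℤ) : ℝ := ((1 + |(m : ℝ)|) ^ s)⁻¹

lemma gw_nonneg (s : ℝ) (m : ℤ) : 0 ≤ gw s m := by unfold gw; positivity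

lemma gw_summable {s : ℝ} (hs : 1 < s) : Summable (gw s) := by
  have h1 : Summable (fun k : ℕ => (((k : ℝ) + 1) ^ s)⁻¹) := by
    have := (summable_nat_add_iff 1).2 (Real.summable_nat_rpow_inv.2 hs)
    simpa using this
  rw [summable_int_iff_summable_nat_and_neg]
  constructor <;>
  · refine h1.congr fun k => ?_
    simp [gw, add_comm]

/-- The half weight. -/
def uw {n : ℕ} (k k' : Fin n → ℤ) : ℝ := ((√(wt k k')) ^ (2 * n + 1))⁻¹

variable {n : ℕ}

lemma wt_one_le (k k' : Fin n → ℤ) : 1 ≤ wt k k' := by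
  unfold wt
  linarith [norm_nonneg (kv k - kv k')]

lemma wt_symm (k k' : Fin n → ℤ) : wt k k' = wt k' k := by
  unfold wt
  rw [norm_sub_rev]

lemma uw_nonneg (k k' : Fin n → ℤ) : 0 ≤ uw k k' := by unfold uw; positivity

lemma uw_sq (k k' : Fin n → ℤ) : uw k k' ^ 2 = (wt k k' ^ (2 * n + 1))⁻¹ := by
  unfold uw
  rw [inv_pow, ← pow_mul, mul_comm, pow_mul, Real.sq_sqrt (by linarith [wt_one_le k k'])]

lemma uw_le (k k' : Fin n → ℤ) : uw k k' ≤ ∏ i, gw (1 + 1 / (2 * n + 1)) (k' i - k i) := by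
  unfold uw gw
  rw [Finset.prod_inv_distrib]
  have hw := wt_one_le k k'
  have hpos : 0 < ∏ i : Fin n, (1 + |((k' i - k i : ℤ) : ℝ)|) ^ ((1 : ℝ) + 1 / (2 * n + 1)) :=
    Finset.prod_pos fun i _ => by positivity
  refine inv_anti₀ hpos ?_
  have h1 : ∀ i : Fin n, (1 + |((k' i - k i : ℤ) : ℝ)|) ≤ wt k k' := by
    intro i
    have := coord_le (kv k - kv k') i
    unfold wt
    have h2 : |((k' i - k i : ℤ) : ℝ)| = |(kv k - kv k') i| := by
      simp [kv]
      rw [abs_sub_comm]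
    rw [h2]
    linarith
  calc ∏ i : Fin n, (1 + |((k' i - k i : ℤ) : ℝ)|) ^ ((1 : ℝ) + 1 / (2 * n + 1))
      ≤ ∏ i : Fin n, (wt k k') ^ ((1 : ℝ) + 1 / (2 * n + 1)) :=
        Finset.prod_le_prod (fun i _ => by positivity) (fun i _ =>
          Real.rpow_le_rpow (by positivity) (h1 i) (by positivity))
    _ = (wt k k') ^ (((1 : ℝ) + 1 / (2 * n + 1)) * n) := by
        rw [Finset.prod_const, Finset.card_univ, Fintype.card_fin, Real.rpow_mul (by linarith),
          Real.rpow_natCast]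
    _ ≤ (wt k k') ^ ((1 / 2 : ℝ) * ((2 * n + 1 : ℕ) : ℝ)) := by
        refine Real.rpow_le_rpow_of_exponent_le hw ?_
        push_cast
        have : (0 : ℝ) < 2 * n + 1 := by positivity
        rw [add_mul, one_mul, div_mul_eq_mul_div, one_mul]
        have h3 : (n : ℝ) / (2 * n + 1) ≤ 1 / 2 := by
          rw [div_le_div_iff₀ this (by norm_num)]
          linarith
        linarith
    _ = _ := by
        rw [Real.rpow_mul (by linarith), Real.rpow_natCast, Real.sqrt_eq_rpow]

lemma uw_sum (n : ℕ) : ∃ W, 0 ≤ W ∧ ∀ R, ∀ k : Fin n → ℤ, ∑ k' ∈ box n R, uw k k' ≤ W := by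
  set s : ℝ := 1 + 1 / (2 * n + 1) with hs
  have hs1 : 1 < s := by
    have : (0 : ℝ) < 1 / (2 * n + 1) := by positivity
    linarith
  have hsum := gw_summable hs1
  have h0 : 0 ≤ ∑' m, gw s m := tsum_nonneg (gw_nonneg s)
  refine ⟨(∑' m, gw s m) ^ n, by positivity, fun R k => ?_⟩
  refine (Finset.sum_le_sum fun k' _ => uw_le k k').trans ?_
  have : ∑ k' ∈ box n R, ∏ i, gw s (k' i - k i) =
      ∏ i : Fin n, ∑ m ∈ Finset.Icc (-(R : ℤ)) R, gw s (m - k i) := by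
    rw [Finset.prod_univ_sum]; rfl
  rw [← hs, this]
  calc ∏ i : Fin n, ∑ m ∈ Finset.Icc (-(R : ℤ)) R, gw s (m - k i)
      ≤ ∏ i : Fin n, ∑' m, gw s m := by
        refine Finset.prod_le_prod (fun i _ => Finset.sum_nonneg fun m _ => gw_nonneg _ _) fun i _ => ?_
        have hsh : Summable (fun m => gw s (m - k i)) := ((Equiv.subRight (k i)).summable_iff).2 hsum
        refine (hsh.sum_le_tsum _ (fun m _ => gw_nonneg _ _)).trans (le_of_eq ?_)
        exact (Equiv.subRight (k i)).tsum_eq (gw s)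
    _ = _ := by simp

end weights

section assembly
variable {n : ℕ}

local notation "E" => EuclideanSpace ℝ (Fin n)

lemma Ker_cont {C₀ M : ℝ} {a : E × E → ℂ} {φ : E × E → ℝ} (h : Good n C₀ M a φ) (k l : Fin n → ℤ) :
    Continuous (Function.uncurry (Ker a φ k l)) := by
  have h1 := h.sa.continuous
  have h2 := h.sφ.continuous
  have h3 := (bump_smooth k).continuous
  have h4 := (bump_smooth l).continuous
  unfold Ker Function.uncurry
  fun_prop

lemma Ker_KP {C₀ M : ℝ} {a : E × E → ℂ} {φ : E × E → ℝ} (h : Good n C₀ M a φ) (k l : Fin n → ℤ) :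
    KP volume (Ker a φ k l) (Metric.closedBall (kv k) n) (Metric.closedBall (kv l) n) 1 where
  meas := (Ker_cont h k l).stronglyMeasurable
  M0 := zero_le_one
  bd := Ker_norm h k l
  z := Ker_zero a φ k l
  mS := Metric.isClosed_closedBall.measurableSet
  mS' := Metric.isClosed_closedBall.measurableSet
  fS := measure_closedBall_lt_top
  fS' := measure_closedBall_lt_top

lemma Ker_swap (a : E × E → ℂ) (φ : E × E → ℝ) (k l : Fin n → ℤ) (x y : E) :
    Ker a φ k l x y = Ker (fun z => a z.swap) (fun z => φ z.swap) l k y x := by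
  unfold Ker
  simp only [Prod.swap_prod_mk]
  ring

lemma vol_ball (k : E) : volume.real (Metric.closedBall k (n : ℝ)) =
    volume.real (Metric.closedBall (0 : E) (n : ℝ)) := by
  simp only [measureReal_def]
  congr 1
  exact Measure.addHaar_closedBall_center _ _ _

/-- Truncated operators are uniformly bounded. -/
lemma trunc_bound (n : ℕ) (C₀ M : ℝ) (hC₀ : 0 < C₀) : ∃ B, 0 ≤ B ∧ ∀ a φ,
    ∀ h : Good n C₀ M a φ, ∀ R,
      ‖∑ j : (box n R) × (box n R), (Ker_KP h j.1 j.2).op‖ ≤ B := by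
  obtain ⟨C, hC0, hC⟩ := key_decay n C₀ M hC₀
  obtain ⟨W, hW0, hW⟩ := uw_sum n
  set V := volume.real (Metric.closedBall (0 : EuclideanSpace ℝ (Fin n)) (n : ℝ)) with hV
  have hV0 : 0 ≤ V := measureReal_nonneg
  refine ⟨√(C * V) * (W * W), by positivity, fun a φ h R => ?_⟩
  have hsq : ∀ k l k' l' : Fin n → ℤ, (√(C * V) * (uw k k' * uw l l')) ^ 2 =
      C / (wt k k' * wt l l') ^ (2 * n + 1) * V := by
    intro k l k' l'
    rw [mul_pow, mul_pow, Real.sq_sqrt (by positivity), uw_sq, uw_sq, mul_pow]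
    field_simp
  have hwpos : ∀ k l k' l' : Fin n → ℤ, 0 < (wt k k' * wt l l') ^ (2 * n + 1) := by
    intro k l k' l'
    have h1 := wt_one_le k k'
    have h2 := wt_one_le l l'
    exact pow_pos (mul_pos (by linarith) (by linarith)) _
  refine Cotlar.cotlar (fun j : (box n R) × (box n R) => (Ker_KP h j.1 j.2).op)
    (fun j j' => √(C * V) * (uw (j.1 : Fin n → ℤ) j'.1 * uw (j.2 : Fin n → ℤ) j'.2)) _ (by positivity)
    (fun j j' => mul_nonneg (Real.sqrt_nonneg _) (mul_nonneg (uw_nonneg _ _) (uw_nonneg _ _))) ?_ ?_ ?_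
  · rintro ⟨⟨k, hk⟩, ⟨l, hl⟩⟩ ⟨⟨k', hk'⟩, ⟨l', hl'⟩⟩
    simp only
    rw [hsq, KP.star_op]
    have hB : ∀ y y', ‖compK volume (adjK (Ker a φ k l)) (Ker a φ k' l') y y'‖
        ≤ C / (wt k k' * wt l l') ^ (2 * n + 1) := by
      intro y y'
      rw [le_div_iff₀ (hwpos k l k' l')]
      exact hC a φ h k l k' l' y y'
    rw [KP.op_mul _ _ (div_nonneg hC0 (hwpos k l k' l').le) hB]
    refine (KP.op_norm _).trans ?_
    rw [vol_ball (kv l), vol_ball (kv l'), ← hV, Real.mul_self_sqrt hV0]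
  · rintro ⟨⟨k, hk⟩, ⟨l, hl⟩⟩ ⟨⟨k', hk'⟩, ⟨l', hl'⟩⟩
    simp only
    rw [hsq, KP.star_op]
    have hB : ∀ x x', ‖compK volume (Ker a φ k l) (adjK (Ker a φ k' l')) x x'‖
        ≤ C / (wt k k' * wt l l') ^ (2 * n + 1) := by
      intro x x'
      rw [le_div_iff₀ (hwpos k l k' l')]
      have := hC _ _ h.swap l' k' l k x' x
      rw [wt_symm l' l, wt_symm k' k, mul_comm (wt l l')] at this
      have he : compK volume (Ker a φ k l) (adjK (Ker a φ k' l')) x x' =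
          ∫ y, (starRingEnd ℂ) (Ker (fun z => a z.swap) (fun z => φ z.swap) l' k' y x') *
            Ker (fun z => a z.swap) (fun z => φ z.swap) l k y x := by
        unfold compK adjK
        congr 1
        funext y
        rw [Ker_swap a φ k l, Ker_swap a φ k' l', mul_comm]
      rw [he]
      exact this
    rw [KP.op_mul _ _ (div_nonneg hC0 (hwpos k l k' l').le) hB]
    refine (KP.op_norm _).trans ?_
    rw [vol_ball (kv k), vol_ball (kv k'), ← hV, Real.mul_self_sqrt hV0]
  · rintro ⟨⟨k, hk⟩, ⟨l, hl⟩⟩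
    simp only
    rw [← Finset.mul_sum]
    gcongr
    rw [Fintype.sum_prod_type]
    simp only
    simp only [← Finset.mul_sum]
    rw [← Finset.sum_mul, Finset.sum_coe_sort (box n R) (fun k' => uw k k'),
      Finset.sum_coe_sort (box n R) (fun k' => uw l k')]
    exact mul_le_mul (hW R k) (hW R l) (Finset.sum_nonneg fun _ _ => uw_nonneg _ _) hW0

/-- The cutoff. -/
def chi (R : ℕ) (x : E) : ℝ := ∑ k ∈ box n R, bump k x

/-- The truncated kernel. -/
def KR (a : E × E → ℂ) (φ : E × E → ℝ) (R : ℕ) (x y : E) : ℂ :=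
  cexp (I * φ (x, y)) * a (x, y) * ((chi R x : ℂ) * (chi R y : ℂ))

lemma KR_eq (a : E × E → ℂ) (φ : E × E → ℝ) (R : ℕ) (x y : E) :
    KR a φ R x y = ∑ j : (box n R) × (box n R), Ker a φ j.1 j.2 x y := by
  unfold KR Ker chi
  rw [← Finset.mul_sum, Fintype.sum_prod_type]
  simp only [← Finset.mul_sum]
  rw [← Finset.sum_mul, Finset.sum_coe_sort (box n R) (fun k' => (bump k' x : ℂ)),
      Finset.sum_coe_sort (box n R) (fun k' => (bump k' y : ℂ))]
  push_cast
  rfl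

lemma KR_norm {C₀ M : ℝ} {a : E × E → ℂ} {φ : E × E → ℝ} (h : Good n C₀ M a φ) (R : ℕ)
    (x y : E) : ‖KR a φ R x y‖ ≤ 1 := by
  unfold KR
  rw [norm_mul, norm_mul, norm_mul, mul_comm I, Complex.norm_exp_ofReal_mul_I, one_mul,
    Complex.norm_real, Complex.norm_real]
  exact mul_le_one₀ (h.ax.bound (x, y)) (by positivity)
    (mul_le_one₀ (sum_bump_abs x R) (abs_nonneg _) (sum_bump_abs y R))

lemma KR_cont {C₀ M : ℝ} {a : E × E → ℂ} {φ : E × E → ℝ} (h : Good n C₀ M a φ) (R : ℕ) :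
    Continuous (Function.uncurry (KR a φ R)) := by
  have : Function.uncurry (KR a φ R) = fun p : E × E => ∑ j : (box n R) × (box n R), Ker a φ j.1 j.2 p.1 p.2 := by
    funext p
    exact KR_eq a φ R p.1 p.2
  rw [this]
  exact continuous_finset_sum _ fun j _ => Ker_cont h j.1 j.2

lemma KR_opFun {C₀ M : ℝ} {a : E × E → ℂ} {φ : E × E → ℝ} (h : Good n C₀ M a φ) (R : ℕ)
    {f : E → ℂ} (hf : MemLp f 2 volume) (x : E) :
    opFun volume (KR a φ R) f x = ∑ j : (box n R) × (box n R), opFun volume (Ker a φ j.1 j.2) f x := by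
  unfold opFun
  rw [← integral_finset_sum _ (fun j _ => (Ker_KP h j.1 j.2).integrable hf x)]
  congr 1
  funext y
  rw [KR_eq, Finset.sum_mul]

lemma KR_bound {C₀ M B : ℝ} (hB0 : 0 ≤ B) {a : E × E → ℂ} {φ : E × E → ℝ} (h : Good n C₀ M a φ) (R : ℕ)
    (hB : ‖∑ j : (box n R) × (box n R), (Ker_KP h j.1 j.2).op‖ ≤ B)
    {f : E → ℂ} (hf : MemLp f 2 volume) :
    eLpNorm (opFun volume (KR a φ R) f) 2 volume ≤ ENNReal.ofReal B * eLpNorm f 2 volume := by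
  set T := ∑ j : (box n R) × (box n R), (Ker_KP h j.1 j.2).op with hT
  have h1 : ∀ j : (box n R) × (box n R), (Ker_KP h j.1 j.2).op hf.toLp =ᵐ[volume]
      opFun volume (Ker a φ j.1 j.2) f := by
    intro j
    refine ((Ker_KP h j.1 j.2).op_coe _).trans (Filter.Eventually.of_forall fun x => ?_)
    unfold opFun
    refine integral_congr_ae ?_
    filter_upwards [hf.coeFn_toLp] with y hy
    rw [hy]
  have h2 : T hf.toLp =ᵐ[volume] opFun volume (KR a φ R) f := by
    rw [hT, ContinuousLinearMap.sum_apply]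
    refine (Lp.coeFn_finsetSum _ _).trans ?_
    have := (Filter.eventually_all (l := ae (volume : Measure E))).2 h1
    filter_upwards [this] with x hx
    rw [KR_opFun h R hf x, Finset.sum_apply]
    exact Finset.sum_congr rfl fun j _ => hx j
  rw [← eLpNorm_congr_ae h2]
  have h3 : ‖T hf.toLp‖ ≤ B * ‖hf.toLp‖ := T.le_of_opNorm_le hB _
  have h4 := ENNReal.ofReal_le_ofReal h3
  rw [ENNReal.ofReal_mul hB0, ofReal_norm_eq_enorm, ofReal_norm_eq_enorm, Lp.enorm_def, Lp.enorm_def,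
    eLpNorm_congr_ae hf.coeFn_toLp] at h4
  exact h4

lemma good_bound (n : ℕ) (C₀ M : ℝ) (hC₀ : 0 < C₀) : ∃ B, 0 ≤ B ∧ ∀ a φ, Good n C₀ M a φ →
    ∀ u : 𝓢(EuclideanSpace ℝ (Fin n), ℂ),
      eLpNorm (fun x => ∫ y, Complex.exp (Complex.I * (φ (x, y) : ℂ)) * a (x, y) * u y) 2 volume
        ≤ ENNReal.ofReal B * eLpNorm (⇑u) 2 volume := by
  obtain ⟨B, hB0, hB⟩ := trunc_bound n C₀ M hC₀
  refine ⟨B, hB0, fun a φ h u => ?_⟩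
  have hu : MemLp u 2 volume := u.memLp 2 volume
  have hlim : ∀ x, Filter.Tendsto (fun R => opFun volume (KR a φ R) u x) Filter.atTop
      (nhds (∫ y, Complex.exp (Complex.I * (φ (x, y) : ℂ)) * a (x, y) * u y)) := by
    intro x
    unfold opFun
    refine tendsto_integral_of_dominated_convergence (fun y => ‖u y‖) ?_ u.integrable.norm ?_ ?_
    · intro R
      refine AEStronglyMeasurable.mul ?_ hu.1
      exact ((KR_cont h R).comp (Continuous.prodMk_right x)).aestronglyMeasurable
    · intro R
      refine Filter.Eventually.of_forall fun y => ?_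
      rw [norm_mul]
      exact mul_le_of_le_one_left (norm_nonneg _) (KR_norm h R x y)
    · refine Filter.Eventually.of_forall fun y => ?_
      refine tendsto_const_nhds.congr' ?_
      filter_upwards [Filter.eventually_ge_atTop (⌈max ‖x‖ ‖y‖⌉₊)] with R hR
      have hR' := Nat.ceil_le.1 hR
      unfold KR chi
      rw [sum_bump_one x R ((le_max_left _ _).trans hR'), sum_bump_one y R ((le_max_right _ _).trans hR')]
      simp
  have hF := Lp.eLpNorm_lim_le_liminf_eLpNorm (p := 2) (μ := (volume : Measure (EuclideanSpace ℝ (Fin n))))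
    (f := fun R => opFun volume (KR a φ R) u)
    (fun R => opFun_meas (KR_cont h R).stronglyMeasurable hu.1) _ (Filter.Eventually.of_forall hlim)
  refine hF.trans ?_
  refine Filter.liminf_le_of_le (by isBoundedDefault) ?_
  intro b hb
  obtain ⟨R, hR⟩ := hb.exists
  exact hR.trans (KR_bound hB0 h R (hB a φ h R) hu)

end assembly

end OscInt

open OscInt

/-- Global `L²`-boundedness of oscillatory integral operators
`I_φ u(x) = ∫ e^{iφ(x,y)} a(x,y) u(y) dy` with bounded amplitude and phase with
nondegenerate mixed Hessian having bounded derivatives. -/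
theorem statement0 (n : ℕ) (C₀ : ℝ) (hC₀ : 0 < C₀) (Cph : (Fin n → ℕ) → ℝ) :
    ∃ C : ℝ, 0 < C ∧
      ∀ (a : EuclideanSpace ℝ (Fin n) × EuclideanSpace ℝ (Fin n) → ℂ)
        (φ : EuclideanSpace ℝ (Fin n) × EuclideanSpace ℝ (Fin n) → ℝ),
        ContDiff ℝ (⊤ : ℕ∞) a → ContDiff ℝ (⊤ : ℕ∞) φ →
        (∀ z, C₀ ≤ |Matrix.det (Matrix.of fun i j => mixedHessXY φ i j z)|) →
        (∀ i j : Fin n, ∀ α : Fin n → ℕ, mdeg α ≤ 2 * n + 1 →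
          (∀ z, |mderiv dX α (mixedHessXY φ i j) z| ≤ Cph α) ∧
          (∀ z, |mderiv dY α (mixedHessXY φ i j) z| ≤ Cph α)) →
        ∀ A : ℝ,
        (∀ α β : Fin n → ℕ, mdeg α ≤ 2 * n + 1 → mdeg β ≤ 2 * n + 1 →
          ∀ z, ‖mderiv dX α (mderiv dY β a) z‖ ≤ A) →
        ∀ u : 𝓢(EuclideanSpace ℝ (Fin n), ℂ),
          eLpNorm (fun x => ∫ y, Complex.exp (Complex.I * (φ (x, y) : ℂ)) * a (x, y) * u y)
              2 volume
            ≤ ENNReal.ofReal (C * A) * eLpNorm (⇑u) 2 volume := by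
  set M : ℝ := ∑ α ∈ Fintype.piFinset (fun _ : Fin n => Finset.range (2 * n + 2)), |Cph α| with hM
  have hCM : ∀ α : Fin n → ℕ, mdeg α ≤ 2 * n + 1 → Cph α ≤ M := by
    intro α hα
    refine (le_abs_self _).trans ?_
    refine Finset.single_le_sum (f := fun α => |Cph α|) (fun _ _ => abs_nonneg _) ?_
    rw [Fintype.mem_piFinset]
    intro i
    rw [Finset.mem_range]
    have : α i ≤ mdeg α := Finset.single_le_sum (f := α) (fun _ _ => Nat.zero_le _) (Finset.mem_univ i)
    omega
  obtain ⟨B, hB0, hB⟩ := good_bound n C₀ M hC₀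
  refine ⟨B + 1, by positivity, fun a φ ha hφ hdet hph A hA u => ?_⟩
  have hz : mdeg (0 : Fin n → ℕ) ≤ 2 * n + 1 := by simp [mdeg]
  have hA00 : ∀ z, ‖a z‖ ≤ A := by
    intro z
    have := hA 0 0 hz hz z
    rwa [mderiv_zero, mderiv_zero] at this
  have hAnn : 0 ≤ A := (norm_nonneg _).trans (hA00 0)
  rcases hAnn.eq_or_lt with hA0 | hApos
  · have : ∀ z, a z = 0 := fun z => norm_le_zero_iff.1 (hA0 ▸ hA00 z)
    simp [this]
  have hsc : ∀ w : ℂ, ‖w‖ ≤ A → ‖((A⁻¹ : ℝ) : ℂ) * w‖ ≤ 1 := by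
    intro w hw
    rw [norm_mul, Complex.norm_real, Real.norm_of_nonneg (by positivity), inv_mul_le_iff₀ hApos, mul_one]
    exact hw
  have hgood : Good n C₀ M (fun z => ((A⁻¹ : ℝ) : ℂ) * a z) φ := by
    have hH : ∀ i j, Sm (mixedHessXY φ i j) := fun i j => Sm.dLine (Sm.dLine hφ _) _
    refine ⟨contDiff_const.mul ha, hφ, hdet, fun i j => ?_, fun i j => ?_, ?_, ?_⟩
    · exact PB_of_mderiv (hH i j) _ _ fun α hα z => ((hph i j α hα).1 z).trans (hCM α hα)
    · exact PB_of_mderiv (hH i j) _ _ fun α hα z => ((hph i j α hα).2 z).trans (hCM α hα)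
    · refine PB_of_mderiv (contDiff_const.mul ha) _ _ fun α hα z => ?_
      rw [mderiv_smul _ _ ha]
      have := hA α 0 hα hz z
      rw [mderiv_zero] at this
      exact hsc _ this
    · refine PB_of_mderiv (contDiff_const.mul ha) _ _ fun β hβ z => ?_
      rw [mderiv_smul _ _ ha]
      have := hA 0 β hz hβ z
      rw [mderiv_zero] at this
      exact hsc _ this
  have hmain := hB _ φ hgood u
  have heq : (fun x => ∫ y, Complex.exp (Complex.I * (φ (x, y) : ℂ)) * a (x, y) * u y) =
      (A : ℂ) • (fun x => ∫ y, Complex.exp (Complex.I * (φ (x, y) : ℂ)) * (((A⁻¹ : ℝ) : ℂ) * a (x, y)) * u y) := by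
    funext x
    rw [Pi.smul_apply, smul_eq_mul, ← integral_const_mul]
    congr 1
    funext y
    have : (A : ℂ) ≠ 0 := by exact_mod_cast hApos.ne'
    push_cast
    field_simp
  rw [heq, eLpNorm_const_smul]
  have hAe : ‖(A : ℂ)‖ₑ = ENNReal.ofReal A := by
    rw [← ofReal_norm_eq_enorm, Complex.norm_real, Real.norm_of_nonneg hAnn]
  rw [hAe]
  calc _ ≤ ENNReal.ofReal A * (ENNReal.ofReal B * eLpNorm (⇑u) 2 volume) := by gcongr
    _ = ENNReal.ofReal (B * A) * eLpNorm (⇑u) 2 volume := by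
        rw [ENNReal.ofReal_mul hB0]; ring
    _ ≤ _ := by
        gcongr
        linarith
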